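/- arXiv:math/0605619 — 4 statements merged into one kernel-verified Lean document; each statement's English description precedes it below -/
import Mathlib

section
/- Assume (H1)–(H3) and let α > 0. If u is a bounded, upper semicontinuous, space-time periodic viscosity subsolution and v a bounded, lower semicontinuous, space-time periodic viscosity supersolution of w_t + G(x,y,t,D_x w, D_y w) + α w = 0 on ℝⁿ×ℝ×ℝ, then u ≤ v on ℝⁿ×ℝ×ℝ. -/
open MeasureTheory Topology Filter
open scoped RealInnerProductSpace

noncomputable section

/-- Euclidean space ℝⁿ. -/
abbrev Euc (n : ℕ) := EuclideanSpace ℝ (Fin n)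

/-- Hamiltonians G = G(x, y, t, p_x, p_y). -/
abbrev Ham (n : ℕ) := Euc n → ℝ → ℝ → Euc n → ℝ → ℝ

/-- The space of points (x, y, t) ∈ ℝⁿ×ℝ×ℝ. -/
abbrev Dom (n : ℕ) := Euc n × ℝ × ℝ

/-- The space of points ξ = (x, y, t, p_x, p_y). -/
abbrev Xi (n : ℕ) := Euc n × ℝ × ℝ × Euc n × ℝ

/-- The space of points (x, t) ∈ ℝⁿ×ℝ. -/
abbrev Dom2 (n : ℕ) := Euc n × ℝ

/-- The integer vector k viewed as a point of ℝⁿ. -/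
def intVec {n : ℕ} (k : Fin n → ℤ) : Euc n := WithLp.toLp 2 (fun i => (k i : ℝ))

/-- ∂φ/∂t for φ = φ(x,y,t). -/
def pdT {n : ℕ} (φ : Dom n → ℝ) (z : Dom n) : ℝ := fderiv ℝ φ z (0, 0, 1)

/-- ∂φ/∂y for φ = φ(x,y,t). -/
def pdY {n : ℕ} (φ : Dom n → ℝ) (z : Dom n) : ℝ := fderiv ℝ φ z (0, 1, 0)

/-- D_x φ for φ = φ(x,y,t). -/
def pdX {n : ℕ} (φ : Dom n → ℝ) (z : Dom n) : Euc n :=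
  WithLp.toLp 2 (fun i => fderiv ℝ φ z (EuclideanSpace.single i 1, 0, 0))

/-- ∂φ/∂t for φ = φ(x,t). -/
def pdT2 {n : ℕ} (φ : Dom2 n → ℝ) (z : Dom2 n) : ℝ := fderiv ℝ φ z (0, 1)

/-- D_x φ for φ = φ(x,t). -/
def pdX2 {n : ℕ} (φ : Dom2 n → ℝ) (z : Dom2 n) : Euc n :=
  WithLp.toLp 2 (fun i => fderiv ℝ φ z (EuclideanSpace.single i 1, 0))

/-- Viscosity subsolution of `w_t + G(x,y,t,D_x w,D_y w) + α w = λ` on ℝⁿ×ℝ×ℝ. -/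
def ViscSub {n : ℕ} (G : Ham n) (α lam : ℝ) (u : Dom n → ℝ) : Prop :=
  UpperSemicontinuous u ∧
  ∀ φ : Dom n → ℝ, ContDiff ℝ 1 φ → ∀ z : Dom n,
    IsLocalMax (fun w => u w - φ w) z →
    pdT φ z + G z.1 z.2.1 z.2.2 (pdX φ z) (pdY φ z) + α * u z ≤ lam

/-- Viscosity supersolution of `w_t + G(x,y,t,D_x w,D_y w) + α w = λ` on ℝⁿ×ℝ×ℝ. -/
def ViscSuper {n : ℕ} (G : Ham n) (α lam : ℝ) (u : Dom n → ℝ) : Prop :=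
  LowerSemicontinuous u ∧
  ∀ φ : Dom n → ℝ, ContDiff ℝ 1 φ → ∀ z : Dom n,
    IsLocalMin (fun w => u w - φ w) z →
    lam ≤ pdT φ z + G z.1 z.2.1 z.2.2 (pdX φ z) (pdY φ z) + α * u z

/-- Viscosity solution of `w_t + G(x,y,t,D_x w,D_y w) + α w = λ` on ℝⁿ×ℝ×ℝ. -/
def ViscSol {n : ℕ} (G : Ham n) (α lam : ℝ) (u : Dom n → ℝ) : Prop :=
  Continuous u ∧ ViscSub G α lam u ∧ ViscSuper G α lam u

/-- ℤⁿ-periodicity in x, 1-periodicity in y and t. -/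
def STPeriodic {n : ℕ} (u : Dom n → ℝ) : Prop :=
  (∀ (k : Fin n → ℤ) (x : Euc n) (y t : ℝ), u (x + intVec k, y, t) = u (x, y, t)) ∧
  (∀ x y t, u (x, y + 1, t) = u (x, y, t)) ∧
  (∀ x y t, u (x, y, t + 1) = u (x, y, t))

/-- Boundedness of a function on ℝⁿ×ℝ×ℝ. -/
def Bdd {n : ℕ} (u : Dom n → ℝ) : Prop := ∃ M, ∀ z, |u z| ≤ M

/-- (H1) : continuity and periodicity of the Hamiltonian. -/
def HypH1 {n : ℕ} (G : Ham n) : Prop :=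
  Continuous (fun ξ : Xi n => G ξ.1 ξ.2.1 ξ.2.2.1 ξ.2.2.2.1 ξ.2.2.2.2) ∧
  (∀ (k : Fin n → ℤ) x y t px py, G (x + intVec k) y t px py = G x y t px py) ∧
  (∀ x y t px py, G x (y + 1) t px py = G x y t px py) ∧
  (∀ x y t px py, G x y (t + 1) px py = G x y t px py)

/-- (H2) : coercivity in p_x at p_y = 0, with constants C₁, C₂ > 0. -/
def HypH2 {n : ℕ} (G : Ham n) (C₁ C₂ : ℝ) : Prop :=
  0 < C₁ ∧ 0 < C₂ ∧ ∀ x y t px, C₁ * ‖px‖ - C₂ ≤ G x y t px 0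

/-- (H2') : coercivity in p_x, locally uniformly in p_y. -/
def HypH2' {n : ℕ} (F : Ham n) : Prop :=
  ∀ R : ℝ, 0 < R → ∃ C₁ C₂ : ℝ, 0 < C₁ ∧ 0 < C₂ ∧
    ∀ x y t px py, |py| ≤ R → C₁ * ‖px‖ - C₂ ≤ F x y t px py

/-- (H3) : local Lipschitz continuity in (y,t,p_y) and a.e. bounds on the
partial derivatives ∂_y G, ∂_t G, ∂_{p_y} G. -/
def HypH3 {n : ℕ} (G : Ham n) (l C₃ C₄ C₅ : ℝ) : Prop :=
  0 ≤ C₃ ∧ 0 ≤ C₄ ∧ 0 ≤ C₅ ∧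
  (∀ (x px : Euc n), LocallyLipschitz (fun q : ℝ × ℝ × ℝ => G x q.1 q.2.1 px q.2.2)) ∧
  (∀ᵐ ξ ∂(volume : Measure (Xi n)),
    |deriv (fun y => G ξ.1 y ξ.2.2.1 ξ.2.2.2.1 ξ.2.2.2.2) ξ.2.1| ≤ C₃ * |ξ.2.2.2.2 + l| ∧
    |deriv (fun t => G ξ.1 ξ.2.1 t ξ.2.2.2.1 ξ.2.2.2.2) ξ.2.2.1| ≤
      C₄ * (1 + |ξ.2.2.2.2| + |G ξ.1 ξ.2.1 ξ.2.2.1 ξ.2.2.2.1 ξ.2.2.2.2|) ∧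
    |deriv (fun py => G ξ.1 ξ.2.1 ξ.2.2.1 ξ.2.2.2.1 py) ξ.2.2.2.2| ≤ C₅)

/-- λ is an ergodic constant : bounded usc subsolution and bounded lsc
supersolution of `w_t + G = λ` exist. -/
def ErgodicConst {n : ℕ} (G : Ham n) (lam : ℝ) : Prop :=
  (∃ u, Bdd u ∧ ViscSub G 0 lam u) ∧ (∃ v, Bdd v ∧ ViscSuper G 0 lam v)

/-- λ solves the cell problem at (p_x,p_y) : the equation
`v_t + F(x,y,t,p_x + D_x v, p_y + D_y v) = λ` has a bounded space-time periodic
usc subsolution and a bounded space-time periodic lsc supersolution. -/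
def CellOk {n : ℕ} (F : Ham n) (px : Euc n) (py lam : ℝ) : Prop :=
  (∃ u, Bdd u ∧ STPeriodic u ∧
    ViscSub (fun x y t qx qy => F x y t (px + qx) (py + qy)) 0 lam u) ∧
  (∃ v, Bdd v ∧ STPeriodic v ∧
    ViscSuper (fun x y t qx qy => F x y t (px + qx) (py + qy)) 0 lam v)

/-- Viscosity subsolution of `w_t + G(x,y,t,D_x w,D_y w) = 0` on ℝⁿ×ℝ×(0,∞). -/
def ViscSubPos {n : ℕ} (G : Ham n) (u : Dom n → ℝ) : Prop :=
  ∀ φ : Dom n → ℝ, ContDiff ℝ 1 φ → ∀ z : Dom n, 0 < z.2.2 →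
    IsLocalMax (fun w => u w - φ w) z →
    pdT φ z + G z.1 z.2.1 z.2.2 (pdX φ z) (pdY φ z) ≤ 0

/-- Viscosity supersolution of `w_t + G(x,y,t,D_x w,D_y w) = 0` on ℝⁿ×ℝ×(0,∞). -/
def ViscSuperPos {n : ℕ} (G : Ham n) (u : Dom n → ℝ) : Prop :=
  ∀ φ : Dom n → ℝ, ContDiff ℝ 1 φ → ∀ z : Dom n, 0 < z.2.2 →
    IsLocalMin (fun w => u w - φ w) z →
    0 ≤ pdT φ z + G z.1 z.2.1 z.2.2 (pdX φ z) (pdY φ z)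

/-- Bounded uniformly continuous (on every slab ℝⁿ×ℝ×[0,T]) viscosity solution of the
initial value problem `v_t + G(x,y,t,D_x v,D_y v) = 0` on ℝⁿ×ℝ×(0,∞), `v(x,y,0) = v₀(x,y)`. -/
def IVPSol {n : ℕ} (G : Ham n) (v₀ : Dom2 n → ℝ) (v : Dom n → ℝ) : Prop :=
  ContinuousOn v {z : Dom n | 0 ≤ z.2.2} ∧
  (∀ x y, v (x, y, 0) = v₀ (x, y)) ∧
  ViscSubPos G v ∧ ViscSuperPos G v ∧
  (∀ T : ℝ, 0 < T →
    (∃ M, ∀ z : Dom n, 0 ≤ z.2.2 → z.2.2 ≤ T → |v z| ≤ M) ∧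
    UniformContinuousOn v {z : Dom n | 0 ≤ z.2.2 ∧ z.2.2 ≤ T})

/-- Viscosity subsolution of the eikonal-type inequality `w_t + c|D_x w| - C ≤ 0` on ℝⁿ×ℝ. -/
def ViscSubEik {n : ℕ} (c C : ℝ) (u : Dom2 n → ℝ) : Prop :=
  UpperSemicontinuous u ∧
  ∀ φ : Dom2 n → ℝ, ContDiff ℝ 1 φ → ∀ z : Dom2 n,
    IsLocalMax (fun w => u w - φ w) z →
    pdT2 φ z + c * ‖pdX2 φ z‖ - C ≤ 0

theorem aux_haar (n : ℕ) : (volume : Measure (Xi n)).IsAddHaarMeasure := by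
  have a : ((volume : Measure (Euc n)).prod (volume : Measure ℝ)).IsAddHaarMeasure := inferInstance
  have b : ((volume : Measure ℝ).prod ((volume : Measure (Euc n)).prod (volume : Measure ℝ))).IsAddHaarMeasure := by
    exact Measure.prod.instIsAddHaarMeasure _ _
  have b : ((volume : Measure ℝ).prod ((volume : Measure ℝ).prod ((volume : Measure (Euc n)).prod (volume : Measure ℝ)))).IsAddHaarMeasure := by
    exact Measure.prod.instIsAddHaarMeasure _ _
  exact Measure.prod.instIsAddHaarMeasure _ _

theorem aux_lip1 {h : ℝ → ℝ} (hh : LocallyLipschitz h) {a b C : ℝ}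
    (hb : ∀ᵐ s, s ∈ Set.uIcc a b → |deriv h s| ≤ C) : |h b - h a| ≤ C * |b - a| := by
  obtain ⟨K, hK⟩ := LocallyLipschitzOn.exists_lipschitzOnWith_of_compact
    (f := h) (s := Set.uIcc a b) isCompact_uIcc (hh.locallyLipschitzOn)
  rw [← hK.absolutelyContinuousOnInterval.integral_deriv_eq_sub, ← Real.norm_eq_abs]
  apply intervalIntegral.norm_integral_le_of_norm_le_const_ae
  filter_upwards [hb] with s hs hs2
  exact hs (Set.uIoc_subset_uIcc hs2)

theorem aux_gron {h : ℝ → ℝ} (hh : LocallyLipschitz h) {b C K : ℝ} (hC : 0 ≤ C) (hK : 0 ≤ K)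
    (hCb : C * |b| ≤ 1 / 2)
    (hb : ∀ᵐ s, |deriv h s| ≤ C * (K + |h s|)) :
    |h b - h 0| ≤ 2 * C * |b| * (K + |h 0|) := by
  obtain ⟨m, hm, hmax⟩ := (isCompact_uIcc (a := (0:ℝ)) (b := b)).exists_isMaxOn
    Set.nonempty_uIcc (f := fun s => |h s|) (hh.continuous.abs.continuousOn)
  set S := |h m| with hS
  have hS' : ∀ s ∈ Set.uIcc 0 b, |h s| ≤ S := fun s hs => hmax hs
  have key : ∀ c ∈ Set.uIcc 0 b, |h c - h 0| ≤ C * |b| * (K + S) := by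
    intro c hc
    have hcb : |c| ≤ |b| := by
      have := Set.abs_sub_left_of_mem_uIcc hc
      simpa using this
    have := aux_lip1 hh (a := 0) (b := c) (C := C * (K + S)) (by
      filter_upwards [hb] with s hs hs2
      refine hs.trans ?_
      have : |h s| ≤ S := hS' s (Set.uIcc_subset_uIcc_left hc hs2)
      gcongr)
    have hS0 : 0 ≤ S := abs_nonneg _
    calc _ ≤ _ := this
      _ = C * (K + S) * |c| := by simp
      _ ≤ C * (K + S) * |b| := by gcongr
      _ = _ := by ring
  have h1 := key m hm
  have h2 := key b Set.right_mem_uIcc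
  have hS0 : 0 ≤ S := abs_nonneg _
  have h3 : S ≤ |h 0| + |h m - h 0| := by
    have := abs_add_le (h 0) (h m - h 0); simpa using this
  have h4 : C * |b| * (K + S) ≤ 1 / 2 * (K + S) := by gcongr
  have h5 : K + S ≤ 2 * (K + |h 0|) := by linarith
  calc _ ≤ _ := h2
    _ ≤ C * |b| * (2 * (K + |h 0|)) := by gcongr
    _ = _ := by ring

theorem aux_line {n : ℕ} {P : Xi n → Prop} (hP : ∀ᵐ ξ ∂(volume : Measure (Xi n)), P ξ) (e : Xi n) :
    ∀ᵐ ξ ∂(volume : Measure (Xi n)), ∀ᵐ s : ℝ, P (ξ + s • e) := by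
  have := aux_haar n
  apply Measure.ae_ae_of_ae_prod (p := fun z : Xi n × ℝ => P (z.1 + z.2 • e))
  set N := toMeasurable (volume : Measure (Xi n)) {ξ | ¬ P ξ}
  have hN0 : volume N = 0 := by rw [measure_toMeasurable]; exact hP
  have hNm : MeasurableSet N := measurableSet_toMeasurable _ _
  have hf : Measurable (fun z : Xi n × ℝ => z.1 + z.2 • e) := by
    have : Continuous (fun z : Xi n × ℝ => z.1 + z.2 • e) := by fun_prop
    exact this.measurable
  have : ((volume : Measure (Xi n)).prod (volume : Measure ℝ))
      ((fun z : Xi n × ℝ => z.1 + z.2 • e) ⁻¹' N) = 0 := by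
    rw [Measure.prod_apply_symm (hf hNm)]
    have : ∀ s : ℝ, (volume : Measure (Xi n))
      ((fun x => (x, s)) ⁻¹' ((fun z : Xi n × ℝ => z.1 + z.2 • e) ⁻¹' N)) = 0 := by
      intro s
      have := measure_preimage_add_right (volume : Measure (Xi n)) (s • e) N
      rw [← hN0, ← this]; rfl
    simp [this]
  refine measure_mono_null ?_ this
  intro z hz
  exact subset_toMeasurable _ _ hz

theorem aux_dense {n : ℕ} {f g : Xi n → ℝ} (hf : Continuous f) (hg : Continuous g)
    (h : ∀ᵐ ξ ∂(volume : Measure (Xi n)), f ξ ≤ g ξ) : ∀ ξ, f ξ ≤ g ξ := by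
  have := aux_haar n
  intro ξ
  have hd := Measure.dense_of_ae h
  have hc : IsClosed {ξ | f ξ ≤ g ξ} := isClosed_le hf hg
  have := hc.closure_eq ▸ hd ξ
  exact this

theorem aux_H3y {n : ℕ} {G : Ham n} {l C₃ C₄ C₅ : ℝ} (h1 : HypH1 G) (h3 : HypH3 G l C₃ C₄ C₅)
    (x : Euc n) (y y' t : ℝ) (p : Euc n) (q : ℝ) :
    |G x y' t p q - G x y t p q| ≤ C₃ * |q + l| * |y' - y| := by
  obtain ⟨-, -, -, hL, hae⟩ := h3
  have hc := h1.1
  have := aux_dense (n := n)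
    (f := fun ξ => |G ξ.1 (ξ.2.1 + (y' - y)) ξ.2.2.1 ξ.2.2.2.1 ξ.2.2.2.2
      - G ξ.1 ξ.2.1 ξ.2.2.1 ξ.2.2.2.1 ξ.2.2.2.2|)
    (g := fun ξ => C₃ * |ξ.2.2.2.2 + l| * |y' - y|)
    (by
      apply Continuous.abs
      apply Continuous.sub _ hc
      exact hc.comp (f := fun ξ : Xi n => ((ξ.1, ξ.2.1 + (y' - y), ξ.2.2.1, ξ.2.2.2.1, ξ.2.2.2.2) : Xi n))
        (by fun_prop)) (by fun_prop) (by
      filter_upwards [aux_line hae ((0, 1, 0, 0, 0) : Xi n)] with ξ hξ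
      have hl : LocallyLipschitz (fun s : ℝ => G ξ.1 (ξ.2.1 + s) ξ.2.2.1 ξ.2.2.2.1 ξ.2.2.2.2) := by
        refine LocallyLipschitz.comp (f := fun q : ℝ × ℝ × ℝ => G ξ.1 q.1 q.2.1 ξ.2.2.2.1 q.2.2) (hL ξ.1 ξ.2.2.2.1) (g := fun s : ℝ => (ξ.2.1 + s, ξ.2.2.1, ξ.2.2.2.2)) ?_
        exact ContDiff.locallyLipschitz (𝕂 := ℝ) (by fun_prop)
      have := aux_lip1 hl (a := 0) (b := y' - y) (C := C₃ * |ξ.2.2.2.2 + l|) (by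
        filter_upwards [hξ] with s hs _
        rw [deriv_comp_const_add (f := fun y => G ξ.1 y ξ.2.2.1 ξ.2.2.2.1 ξ.2.2.2.2)]
        simpa using hs.1)
      simpa using this) (x, y, t, p, q)
  simpa using this

theorem aux_H3q {n : ℕ} {G : Ham n} {l C₃ C₄ C₅ : ℝ} (h1 : HypH1 G) (h3 : HypH3 G l C₃ C₄ C₅)
    (x : Euc n) (y t : ℝ) (p : Euc n) (q q' : ℝ) :
    |G x y t p q' - G x y t p q| ≤ C₅ * |q' - q| := by
  obtain ⟨-, -, -, hL, hae⟩ := h3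
  have hc := h1.1
  have := aux_dense (n := n)
    (f := fun ξ => |G ξ.1 ξ.2.1 ξ.2.2.1 ξ.2.2.2.1 (ξ.2.2.2.2 + (q' - q))
      - G ξ.1 ξ.2.1 ξ.2.2.1 ξ.2.2.2.1 ξ.2.2.2.2|)
    (g := fun ξ => C₅ * |q' - q|)
    (by
      apply Continuous.abs
      apply Continuous.sub _ hc
      exact hc.comp (f := fun ξ : Xi n => ((ξ.1, ξ.2.1, ξ.2.2.1, ξ.2.2.2.1, ξ.2.2.2.2 + (q' - q)) : Xi n))
        (by fun_prop)) (by fun_prop) (by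
      filter_upwards [aux_line hae ((0, 0, 0, 0, 1) : Xi n)] with ξ hξ
      have hl : LocallyLipschitz (fun s : ℝ => G ξ.1 ξ.2.1 ξ.2.2.1 ξ.2.2.2.1 (ξ.2.2.2.2 + s)) := by
        refine LocallyLipschitz.comp (f := fun q : ℝ × ℝ × ℝ => G ξ.1 q.1 q.2.1 ξ.2.2.2.1 q.2.2) (hL ξ.1 ξ.2.2.2.1) (g := fun s : ℝ => (ξ.2.1, ξ.2.2.1, ξ.2.2.2.2 + s)) ?_
        exact ContDiff.locallyLipschitz (𝕂 := ℝ) (by fun_prop)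
      have := aux_lip1 hl (a := 0) (b := q' - q) (C := C₅) (by
        filter_upwards [hξ] with s hs _
        rw [deriv_comp_const_add (f := fun py => G ξ.1 ξ.2.1 ξ.2.2.1 ξ.2.2.2.1 py)]
        simpa using hs.2.2)
      simpa using this) (x, y, t, p, q)
  simpa using this

theorem aux_H3t {n : ℕ} {G : Ham n} {l C₃ C₄ C₅ : ℝ} (h1 : HypH1 G) (h3 : HypH3 G l C₃ C₄ C₅)
    (x : Euc n) (y t t' : ℝ) (p : Euc n) (q : ℝ) (ht : C₄ * |t' - t| ≤ 1 / 2) :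
    |G x y t' p q - G x y t p q| ≤ 2 * C₄ * |t' - t| * (1 + |q| + |G x y t p q|) := by
  obtain ⟨-, hC, -, hL, hae⟩ := h3
  have hc := h1.1
  have := aux_dense (n := n)
    (f := fun ξ => |G ξ.1 ξ.2.1 (ξ.2.2.1 + (t' - t)) ξ.2.2.2.1 ξ.2.2.2.2
      - G ξ.1 ξ.2.1 ξ.2.2.1 ξ.2.2.2.1 ξ.2.2.2.2|)
    (g := fun ξ => 2 * C₄ * |t' - t| *
      (1 + |ξ.2.2.2.2| + |G ξ.1 ξ.2.1 ξ.2.2.1 ξ.2.2.2.1 ξ.2.2.2.2|))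
    (by
      apply Continuous.abs
      apply Continuous.sub _ hc
      exact hc.comp (f := fun ξ : Xi n => ((ξ.1, ξ.2.1, ξ.2.2.1 + (t' - t), ξ.2.2.2.1, ξ.2.2.2.2) : Xi n))
        (by fun_prop)) (by
      apply Continuous.mul (by fun_prop)
      exact Continuous.add (by fun_prop) hc.abs) (by
      filter_upwards [aux_line hae ((0, 0, 1, 0, 0) : Xi n)] with ξ hξ
      have hl : LocallyLipschitz (fun s : ℝ => G ξ.1 ξ.2.1 (ξ.2.2.1 + s) ξ.2.2.2.1 ξ.2.2.2.2) := by
        refine LocallyLipschitz.comp (f := fun q : ℝ × ℝ × ℝ => G ξ.1 q.1 q.2.1 ξ.2.2.2.1 q.2.2) (hL ξ.1 ξ.2.2.2.1) (g := fun s : ℝ => (ξ.2.1, ξ.2.2.1 + s, ξ.2.2.2.2)) ?_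
        exact ContDiff.locallyLipschitz (𝕂 := ℝ) (by fun_prop)
      have := aux_gron hl (b := t' - t) (C := C₄) (K := 1 + |ξ.2.2.2.2|) hC (by positivity) ht (by
        filter_upwards [hξ] with s hs
        rw [deriv_comp_const_add (f := fun t => G ξ.1 ξ.2.1 t ξ.2.2.2.1 ξ.2.2.2.2)]
        simpa using hs.2.1)
      simpa using this) (x, y, t, p, q)
  simpa using this

/-- The quadratic penalization. -/
def pen {n : ℕ} (A D : ℝ) (c w : Dom n) : ℝ :=
  A * ‖w.1 - c.1‖ ^ 2 + D * (w.2.1 - c.2.1) ^ 2 + D * (w.2.2 - c.2.2) ^ 2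

theorem pen_contDiff {n : ℕ} (A D : ℝ) (c : Dom n) : ContDiff ℝ 1 (pen A D c) := by
  have : ContDiff ℝ 1 (fun w : Dom n => ‖w.1 - c.1‖ ^ 2) :=
    ContDiff.norm_sq ℝ (by fun_prop)
  unfold pen
  fun_prop

theorem pen_fderiv {n : ℕ} (A D : ℝ) (c z h : Dom n) :
    fderiv ℝ (pen A D c) z h = 2 * A * inner ℝ (z.1 - c.1) h.1
      + 2 * D * (z.2.1 - c.2.1) * h.2.1 + 2 * D * (z.2.2 - c.2.2) * h.2.2 := by
  have h1 : HasFDerivAt (fun w : Dom n => w.1 - c.1) (ContinuousLinearMap.fst ℝ (Euc n) (ℝ × ℝ)) z :=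
    (hasFDerivAt_fst).sub_const _
  have h2 : HasFDerivAt (fun w : Dom n => w.2.1 - c.2.1)
      ((ContinuousLinearMap.fst ℝ ℝ ℝ).comp (ContinuousLinearMap.snd ℝ (Euc n) (ℝ × ℝ))) z :=
    ((hasFDerivAt_fst).comp z hasFDerivAt_snd).sub_const _
  have h3 : HasFDerivAt (fun w : Dom n => w.2.2 - c.2.2)
      ((ContinuousLinearMap.snd ℝ ℝ ℝ).comp (ContinuousLinearMap.snd ℝ (Euc n) (ℝ × ℝ))) z :=
    ((hasFDerivAt_snd).comp z hasFDerivAt_snd).sub_const _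
  have := ((h1.norm_sq.const_mul A).add ((h2.pow 2).const_mul D)).add ((h3.pow 2).const_mul D)
  rw [inner_sub_left]
  have h4 : HasFDerivAt (pen A D c) _ z := this
  rw [h4.fderiv]
  simp
  ring

theorem pen_pdT {n : ℕ} (A D : ℝ) (c z : Dom n) : pdT (pen A D c) z = 2 * D * (z.2.2 - c.2.2) := by
  simp [pdT, pen_fderiv]

theorem pen_pdY {n : ℕ} (A D : ℝ) (c z : Dom n) : pdY (pen A D c) z = 2 * D * (z.2.1 - c.2.1) := by
  simp [pdY, pen_fderiv]

theorem pen_pdX {n : ℕ} (A D : ℝ) (c z : Dom n) :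
    pdX (pen A D c) z = (2 * A) • (z.1 - c.1) := by
  ext i
  simp [pdX, pen_fderiv, EuclideanSpace.inner_single_right]

theorem per_int {n : ℕ} {u : Dom n → ℝ} (h : STPeriodic u) (k : Fin n → ℤ) (a b : ℤ) (w : Dom n) :
    u (w + (intVec k, (a : ℝ), (b : ℝ))) = u w := by
  obtain ⟨x, y, t⟩ := w
  have e : ((x, y, t) : Dom n) + (intVec k, (a : ℝ), (b : ℝ)) = (x + intVec k, y + a, t + b) := rfl
  rw [e, h.1]
  have p1 : Function.Periodic (fun y => u (x, y, t + b)) 1 := fun y => h.2.1 x y _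
  have p2 : Function.Periodic (fun t => u (x, y, t)) 1 := fun t => h.2.2 x y t
  have q1 := p1.int_mul a y
  have q2 := p2.int_mul b t
  simp only [mul_one] at q1 q2
  rw [q1, q2]

theorem exists_trans {n : ℕ} (z : Dom n) : ∃ T : Dom n, ‖z + T‖ ≤ Real.sqrt n + 1 ∧
    ∀ u : Dom n → ℝ, STPeriodic u → ∀ w, u (w + T) = u w := by
  refine ⟨(intVec (fun i => -⌊z.1 i⌋), ((-⌊z.2.1⌋ : ℤ) : ℝ), ((-⌊z.2.2⌋ : ℤ) : ℝ)), ?_,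
    fun u hu w => per_int hu _ _ _ w⟩
  have f1 : ∀ a : ℝ, |a + ((-⌊a⌋ : ℤ) : ℝ)| ≤ 1 := by
    intro a
    have := Int.floor_le a
    have := Int.lt_floor_add_one a
    push_cast
    rw [abs_le]; constructor <;> linarith
  have hs := Real.sqrt_nonneg n
  rw [Prod.norm_def, Prod.norm_def]
  refine max_le ?_ (max_le ?_ ?_)
  · rw [EuclideanSpace.norm_eq]
    refine (Real.sqrt_le_sqrt ?_).trans (by linarith : Real.sqrt n ≤ _)
    calc _ ≤ ∑ i : Fin n, (1 : ℝ) := by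
          apply Finset.sum_le_sum
          intro i _
          have := f1 (z.1 i)
          have e : (z + (intVec (fun i => -⌊z.1 i⌋), ((-⌊z.2.1⌋ : ℤ) : ℝ), ((-⌊z.2.2⌋ : ℤ) : ℝ))).1 i
            = z.1 i + ((-⌊z.1 i⌋ : ℤ) : ℝ) := rfl
          rw [e, Real.norm_eq_abs]
          exact pow_le_one₀ (abs_nonneg _) this
      _ = n := by simp
  · have := f1 z.2.1
    refine le_trans this (by linarith)
  · have := f1 z.2.2
    refine le_trans this (by linarith)

theorem pen_ge {n : ℕ} {A D r : ℝ} (hA : 1 ≤ A) (hD : 1 ≤ D) (hr : 0 ≤ r) {c w : Dom n}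
    (h : r < dist w c) : r ^ 2 ≤ pen A D c w := by
  rw [Prod.dist_eq, Prod.dist_eq, lt_max_iff, lt_max_iff, dist_eq_norm, Real.dist_eq, Real.dist_eq] at h
  have e1 : 0 ≤ ‖w.1 - c.1‖ ^ 2 := by positivity
  have e2 : 0 ≤ (w.2.1 - c.2.1) ^ 2 := by positivity
  have e3 : 0 ≤ (w.2.2 - c.2.2) ^ 2 := by positivity
  unfold pen
  rcases h with h | h | h
  · have : r ^ 2 ≤ ‖w.1 - c.1‖ ^ 2 := by gcongr
    nlinarith
  · have : r ^ 2 ≤ (w.2.1 - c.2.1) ^ 2 := by rw [← sq_abs (w.2.1 - c.2.1)]; gcongr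
    nlinarith
  · have : r ^ 2 ≤ (w.2.2 - c.2.2) ^ 2 := by rw [← sq_abs (w.2.2 - c.2.2)]; gcongr
    nlinarith

theorem usc_diff {n : ℕ} {u v : Dom n → ℝ} (hu : UpperSemicontinuous u)
    (hv : LowerSemicontinuous v) :
    UpperSemicontinuous (fun s : Dom n × Dom n => u s.1 - v s.2) := by
  have a : UpperSemicontinuous (fun s : Dom n × Dom n => u s.1) := hu.comp continuous_fst
  have b : LowerSemicontinuous (fun s : Dom n × Dom n => v s.2) := hv.comp continuous_snd
  have b' : UpperSemicontinuous (fun s : Dom n × Dom n => - v s.2) := by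
    intro s y hy
    filter_upwards [b s (-y) (by linarith)] with w hw
    linarith
  simpa [sub_eq_add_neg] using a.add b'

theorem exists_max {n : ℕ} {u v : Dom n → ℝ} (hu : UpperSemicontinuous u)
    (hv : LowerSemicontinuous v) (hup : STPeriodic u) (hvp : STPeriodic v) {B : ℝ}
    (hB : 0 ≤ B)
    (hub : ∀ z, |u z| ≤ B) (hvb : ∀ z, |v z| ≤ B) {A D : ℝ} (hA : 1 ≤ A) (hD : 1 ≤ D) :
    ∃ z z' : Dom n, ‖z‖ ≤ Real.sqrt n + 1 ∧ dist z z' ≤ 4 * B + 1 ∧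
      ∀ w w', u w - v w' - pen A D w' w ≤ u z - v z' - pen A D z' z := by
  set R := Real.sqrt n + 1 with hR
  have hR0 : 0 ≤ R := by positivity
  set K : Set (Dom n × Dom n) := (Metric.closedBall 0 R ×ˢ Metric.closedBall 0 (R + (4 * B + 1))) ∩
    {s | dist s.1 s.2 ≤ 4 * B + 1} with hK
  have hKc : IsCompact K := by
    apply IsCompact.inter_right
    · exact (isCompact_closedBall _ _).prod (isCompact_closedBall _ _)
    · exact isClosed_le (by fun_prop) (by fun_prop)
  have h0 : ((0, 0) : Dom n × Dom n) ∈ K := by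
    simp only [hK, Set.mem_inter_iff, Set.mem_prod, Metric.mem_closedBall, dist_self,
      Set.mem_ofPred_eq]
    refine ⟨⟨hR0, ?_⟩, ?_⟩ <;> linarith
  have husc : UpperSemicontinuous (fun s : Dom n × Dom n => u s.1 - v s.2 - pen A D s.2 s.1) := by
    have c : Continuous (fun s : Dom n × Dom n => - pen A D s.2 s.1) := by
      unfold pen; fun_prop
    simpa [sub_eq_add_neg] using (usc_diff hu hv).add c.upperSemicontinuous
  obtain ⟨⟨z, z'⟩, hz, hmax⟩ := UpperSemicontinuousOn.exists_isMaxOn ⟨_, h0⟩ hKc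
    (husc.upperSemicontinuousOn K)
  have hmax' : ∀ s ∈ K, u s.1 - v s.2 - pen A D s.2 s.1 ≤ u z - v z' - pen A D z' z :=
    fun s hs => hmax hs
  refine ⟨z, z', ?_, hz.2, ?_⟩
  · simpa using hz.1.1
  intro w w'
  by_cases hd : dist w w' ≤ 4 * B + 1
  · obtain ⟨T, hT, hper⟩ := exists_trans w
    have := hmax' (w + T, w' + T) (by
      simp only [hK, Set.mem_inter_iff, Set.mem_prod, Metric.mem_closedBall, dist_zero_right,
        Set.mem_ofPred_eq, dist_add_right]
      refine ⟨⟨hT, ?_⟩, hd⟩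
      have e : w' + T = (w + T) - (w - w') := by abel
      rw [e]
      refine (norm_sub_le _ _).trans ?_
      rw [dist_eq_norm] at hd
      linarith)
    simp only [hper u hup, hper v hvp] at this
    simpa [pen] using this
  · have h2 := pen_ge hA hD (by positivity) (not_le.1 hd)
    have h3 := hmax' _ h0
    have h4 : pen A D (0 : Dom n) 0 = 0 := by simp [pen]
    simp only [h4] at h3
    have := abs_le.1 (hub w); have := abs_le.1 (hub 0)
    have := abs_le.1 (hvb w'); have := abs_le.1 (hvb 0)
    nlinarith

theorem claim1 {n : ℕ} {u v : Dom n → ℝ} (hu : UpperSemicontinuous u)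
    (hv : LowerSemicontinuous v) {M η R : ℝ} (hη : 0 < η) (hM : ∀ z, u z - v z ≤ M) :
    ∃ r > 0, ∀ z z' : Dom n, ‖z‖ ≤ R → dist z z' ≤ r → u z - v z' ≤ M + η := by
  set K : Set (Dom n × Dom n) := (Metric.closedBall 0 R ×ˢ Metric.closedBall 0 (R + 1)) ∩
    ((fun s : Dom n × Dom n => u s.1 - v s.2) ⁻¹' Set.Ici (M + η)) with hK
  have hKc : IsCompact K := by
    apply IsCompact.inter_right
    · exact (isCompact_closedBall _ _).prod (isCompact_closedBall _ _)
    · exact (usc_diff hu hv).isClosed_preimage _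
  have mem : ∀ r ≤ 1, ∀ z z' : Dom n, ‖z‖ ≤ R → dist z z' ≤ r → ¬ (u z - v z' ≤ M + η) →
      (z, z') ∈ K := by
    intro r hr z z' hz hd hn
    simp only [hK, Set.mem_inter_iff, Set.mem_prod, Metric.mem_closedBall, dist_zero_right,
        Set.mem_preimage, Set.mem_Ici]
    refine ⟨⟨hz, ?_⟩, (not_le.1 hn).le⟩
    have e : z' = z - (z - z') := by abel
    rw [e]
    refine (norm_sub_le _ _).trans ?_
    rw [dist_eq_norm] at hd
    linarith
  rcases K.eq_empty_or_nonempty with h | h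
  · refine ⟨1, one_pos, fun z z' hz hd => ?_⟩
    by_contra hn
    have := mem 1 le_rfl z z' hz hd hn
    rw [h] at this; exact this
  · obtain ⟨⟨a, a'⟩, ha, hmin⟩ := hKc.exists_isMinOn h
      (f := fun s : Dom n × Dom n => dist s.1 s.2) (by fun_prop)
    have hmin' : ∀ s ∈ K, dist a a' ≤ dist s.1 s.2 := fun s hs => hmin hs
    have hpos : 0 < dist a a' := by
      rw [dist_pos]
      rintro rfl
      have h1 : M + η ≤ u a - v a := ha.2
      linarith [hM a]
    refine ⟨min 1 (dist a a' / 2), by positivity, fun z z' hz hd => ?_⟩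
    by_contra hn
    have h1 := hmin' _ (mem _ (min_le_left _ _) z z' hz hd hn)
    have h2 := hd.trans (min_le_right _ _)
    simp only at h1
    linarith

theorem final_arith {C₃ C₄ C₅ l αB C₂ η D a b g : ℝ} (h3 : 0 ≤ C₃) (h4 : 0 ≤ C₄) (h5 : 0 ≤ C₅)
    (hαB : 0 ≤ αB) (hC2 : 0 ≤ C₂) (hη : 0 ≤ η)
    (ha : 0 ≤ a) (hb : 0 ≤ b) (haη : a ≤ η) (hbη : b ≤ η)
    (hD : 0 ≤ D) (hDa : D * a ^ 2 ≤ η) (hDb : D * b ^ 2 ≤ η)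
    (hg : g ≤ 2 * D * b + C₅ * (2 * D * a) + αB + C₂) :
    C₃ * (2 * D * a + |l|) * a + 2 * C₄ * b * (1 + 2 * D * a + g) ≤
      η * (C₃ * (2 + |l|) + 2 * C₄ * (5 + αB + C₂ + 2 * C₅)) := by
  have hab : D * a * b ≤ η := by nlinarith [mul_nonneg hD (sq_nonneg (a - b))]
  have e1 : (2 * D * a + |l|) * a ≤ η * (2 + |l|) := by
    nlinarith [mul_le_mul_of_nonneg_left haη (abs_nonneg l)]
  have e2 : b * (1 + 2 * D * a + g) ≤ η * (5 + αB + C₂ + 2 * C₅) := by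
    have q1 : b * g ≤ b * (2 * D * b + C₅ * (2 * D * a) + αB + C₂) := by gcongr
    have q2 : C₅ * (D * a * b) ≤ C₅ * η := by gcongr
    have q3 : (αB + C₂) * b ≤ (αB + C₂) * η := by gcongr
    nlinarith
  have e3 := mul_le_mul_of_nonneg_left e1 h3
  have e4 := mul_le_mul_of_nonneg_left e2 h4
  nlinarith

theorem aux_unif {n : ℕ} {G : Ham n} (h1 : HypH1 G) (R : ℝ) {η : ℝ} (hη : 0 < η) :
    ∃ ρ > 0, ∀ (x x' : Euc n) (y t : ℝ) (p : Euc n) (q : ℝ), ‖x‖ ≤ R → ‖x'‖ ≤ R → |y| ≤ R →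
      |t| ≤ R → ‖p‖ ≤ R → |q| ≤ R → ‖x - x'‖ ≤ ρ → G x' y t p q - G x y t p q ≤ η := by
  have hc := h1.1
  have huc := (isCompact_closedBall (0 : Xi n) R).uniformContinuousOn_of_continuous hc.continuousOn
  rw [Metric.uniformContinuousOn_iff] at huc
  obtain ⟨ρ, hρ, h⟩ := huc η hη
  refine ⟨ρ / 2, by positivity, ?_⟩
  intro x x' y t p q hx hx' hy ht hp hq hd
  have := h (x', y, t, p, q) (by simp [Prod.norm_def, *]) (x, y, t, p, q)
    (by simp [Prod.norm_def, *]) (by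
      have e : dist x' x < ρ := by
        rw [dist_comm, dist_eq_norm]; linarith
      simp only [Prod.dist_eq, dist_self, max_self]
      exact max_lt e hρ)
  rw [Real.dist_eq] at this
  exact (le_abs_self _).trans this.le

theorem le_sq_aux {a b : ℝ} (h : a ^ 2 ≤ b ^ 2) (hb : 0 ≤ b) : a ≤ b := abs_le_of_sq_le_sq h hb |> (le_abs_self a).trans

set_option maxHeartbeats 2000000 in
/-- Under (H1)–(H3), comparison principle : a bounded usc space-time
periodic viscosity subsolution of `w_t + G + α w = 0` (α > 0) lies below any bounded
lsc space-time periodic viscosity supersolution. -/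
theorem statement5 {n : ℕ} (hn : 0 < n) (G : Ham n) (C₁ C₂ l C₃ C₄ C₅ : ℝ)
    (h1 : HypH1 G) (h2 : HypH2 G C₁ C₂) (h3 : HypH3 G l C₃ C₄ C₅)
    (α : ℝ) (hα : 0 < α) (u v : Dom n → ℝ)
    (hub : Bdd u) (hup : STPeriodic u) (husub : ViscSub G α 0 u)
    (hvb : Bdd v) (hvp : STPeriodic v) (hvsuper : ViscSuper G α 0 v) :
    ∀ z : Dom n, u z ≤ v z := by
  intro z₀
  by_contra hcon
  have hz₀ : 0 < u z₀ - v z₀ := by linarith [not_le.1 hcon]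
  obtain ⟨B₁, hB₁⟩ := hub
  obtain ⟨B₂, hB₂⟩ := hvb
  obtain ⟨B, hBu, hBv⟩ : ∃ B, (∀ z, |u z| ≤ B) ∧ ∀ z, |v z| ≤ B :=
    ⟨max B₁ B₂, fun z => (hB₁ z).trans (le_max_left _ _), fun z => (hB₂ z).trans (le_max_right _ _)⟩
  have hB : 0 ≤ B := (abs_nonneg _).trans (hBu z₀)
  obtain ⟨hC1, hC2, hcoer⟩ := h2
  have h3C := h3
  obtain ⟨hC3, hC4, hC5, -, -⟩ := h3C
  -- the supremum of u - v
  have hbdd : BddAbove (Set.range fun z => u z - v z) := by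
    refine ⟨2 * B, ?_⟩
    rintro _ ⟨z, rfl⟩
    have := abs_le.1 (hBu z); have := abs_le.1 (hBv z)
    simp only
    linarith
  set M := ⨆ z, (u z - v z) with hMdef
  have hM : ∀ z, u z - v z ≤ M := fun z => le_ciSup hbdd z
  have hMpos : 0 < M := hz₀.trans_le (hM z₀)
  -- the choice of η
  set Q := 1 + (C₃ * (2 + |l|) + 2 * C₄ * (5 + α * B + C₂ + 2 * C₅)) with hQ
  have hQ1 : 1 ≤ Q := by
    have : 0 ≤ C₃ * (2 + |l|) + 2 * C₄ * (5 + α * B + C₂ + 2 * C₅) := by positivity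
    linarith
  obtain ⟨η, hη, hη1, hη2⟩ : ∃ η > 0, η * Q < α * M ∧ C₄ * η ≤ 1 / 2 := by
    refine ⟨min (α * M / (2 * Q)) (1 / (2 * (C₄ + 1))), by positivity, ?_, ?_⟩
    · have h := min_le_left (α * M / (2 * Q)) (1 / (2 * (C₄ + 1)))
      calc _ ≤ α * M / (2 * Q) * Q := by gcongr
        _ = α * M / 2 := by field_simp
        _ < _ := by linarith [mul_pos hα hMpos]
    · have h := min_le_right (α * M / (2 * Q)) (1 / (2 * (C₄ + 1)))
      calc _ ≤ C₄ * (1 / (2 * (C₄ + 1))) := by gcongr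
        _ ≤ (C₄ + 1) * (1 / (2 * (C₄ + 1))) := by gcongr; linarith
        _ = 1 / 2 := by field_simp
  set R := Real.sqrt n + 1 with hR
  have hR0 : 0 ≤ R := by positivity
  obtain ⟨r, hr, hclaim⟩ := claim1 (R := R) husub.1 hvsuper.1 hη hM
  -- the choice of D
  obtain ⟨D, hD1, hDη, hDr⟩ : ∃ D : ℝ, 1 ≤ D ∧ 1 ≤ D * η ∧ 2 * B ≤ D * r ^ 2 := by
    refine ⟨1 + 1 / η + 2 * B / r ^ 2, ?_, ?_, ?_⟩
    · have : 0 ≤ 1 / η + 2 * B / r ^ 2 := by positivity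
      linarith
    · have e : (1 + 1 / η + 2 * B / r ^ 2) * η = η + 1 + 2 * B / r ^ 2 * η := by field_simp
      have : 0 ≤ 2 * B / r ^ 2 * η := by positivity
      linarith
    · have e : (1 + 1 / η + 2 * B / r ^ 2) * r ^ 2 = r ^ 2 + 1 / η * r ^ 2 + 2 * B := by field_simp
      have : 0 ≤ r ^ 2 + 1 / η * r ^ 2 := by positivity
      linarith
  set R₁ := R + (4 * B + 1) with hR₁
  set Rq := 2 * D * (4 * B + 1) with hRq
  set Rp := (C₂ + C₅ * Rq + Rq + α * B) / C₁ with hRp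
  have hRq0 : 0 ≤ Rq := by positivity
  have hRp0 : 0 ≤ Rp := by positivity
  obtain ⟨ρ, hρ, hunif⟩ := aux_unif h1 (R₁ + Rq + Rp) hη
  -- the choice of A
  obtain ⟨A, hA1, hAr, hAρ⟩ : ∃ A : ℝ, 1 ≤ A ∧ 2 * B ≤ A * r ^ 2 ∧ 2 * B ≤ A * ρ ^ 2 := by
    refine ⟨1 + 2 * B / r ^ 2 + 2 * B / ρ ^ 2, ?_, ?_, ?_⟩
    · have : 0 ≤ 2 * B / r ^ 2 + 2 * B / ρ ^ 2 := by positivity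
      linarith
    · have e : (1 + 2 * B / r ^ 2 + 2 * B / ρ ^ 2) * r ^ 2
        = r ^ 2 + 2 * B + 2 * B / ρ ^ 2 * r ^ 2 := by field_simp
      have : 0 ≤ r ^ 2 + 2 * B / ρ ^ 2 * r ^ 2 := by positivity
      linarith
    · have e : (1 + 2 * B / r ^ 2 + 2 * B / ρ ^ 2) * ρ ^ 2
        = ρ ^ 2 + 2 * B / r ^ 2 * ρ ^ 2 + 2 * B := by field_simp
      have : 0 ≤ ρ ^ 2 + 2 * B / r ^ 2 * ρ ^ 2 := by positivity
      linarith
  have hA0 : 0 < A := by linarith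
  have hD0 : 0 < D := by linarith
  obtain ⟨z, z', hzR, hdz, hmax⟩ :=
    exists_max husub.1 hvsuper.1 hup hvp hB hBu hBv hA1 hD1
  have hpen0 : ∀ w : Dom n, pen A D w w = 0 := by intro w; simp [pen]
  have hMle : M ≤ u z - v z' - pen A D z' z := by
    apply ciSup_le
    intro w
    have := hmax w w
    rw [hpen0] at this
    linarith
  -- viscosity inequalities
  have hsub := husub.2 (pen A D z') (pen_contDiff A D z') z (by
    refine Filter.Eventually.of_forall fun w => ?_
    have := hmax w z'
    simp only
    linarith)
  have hsup := hvsuper.2 (pen (-A) (-D) z) (pen_contDiff (-A) (-D) z) z' (by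
    refine Filter.Eventually.of_forall fun w => ?_
    have := hmax z w
    have e : ∀ w : Dom n, pen (-A) (-D) z w = - pen A D w z := by
      intro w
      simp only [pen]
      rw [norm_sub_rev]
      ring
    simp only [e]
    linarith)
  rw [pen_pdT, pen_pdX, pen_pdY] at hsub hsup
  have ep : (2 * -A) • (z'.1 - z.1) = (2 * A) • (z.1 - z'.1) := by
    rw [← neg_sub z.1 z'.1, smul_neg, mul_neg, neg_smul, neg_neg]
  have eq : 2 * -D * (z'.2.1 - z.2.1) = 2 * D * (z.2.1 - z'.2.1) := by ring
  have eτ : 2 * -D * (z'.2.2 - z.2.2) = 2 * D * (z.2.2 - z'.2.2) := by ring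
  rw [ep, eq, eτ] at hsup
  have hpenv : pen A D z' z = A * ‖z.1 - z'.1‖ ^ 2 + D * (z.2.1 - z'.2.1) ^ 2
    + D * (z.2.2 - z'.2.2) ^ 2 := rfl
  clear_value M Q R
  obtain ⟨x, y, t⟩ := z
  obtain ⟨x', y', t'⟩ := z'
  simp only at hsub hsup hpenv
  rw [Prod.dist_eq, Prod.dist_eq, max_le_iff, max_le_iff] at hdz
  simp only [dist_eq_norm, Real.norm_eq_abs] at hdz
  obtain ⟨hdx, hdy, hdt⟩ := hdz
  rw [Prod.norm_def, Prod.norm_def, max_le_iff, max_le_iff] at hzR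
  simp only [Real.norm_eq_abs, ← hR] at hzR
  obtain ⟨hxR, hyR, htR⟩ := hzR
  set p := (2 * A) • (x - x') with hp
  set q := 2 * D * (y - y') with hq
  set τ := 2 * D * (t - t') with hτ
  have hqa : |q| = 2 * D * |y - y'| := by
    rw [hq, abs_mul, abs_of_pos (by positivity : 0 < 2 * D)]
  have hτa : |τ| = 2 * D * |t - t'| := by
    rw [hτ, abs_mul, abs_of_pos (by positivity : 0 < 2 * D)]
  have hqR : |q| ≤ Rq := by rw [hqa, hRq]; gcongr
  have hτR : |τ| ≤ Rq := by rw [hτa, hRq]; gcongr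
  have hub1 := abs_le.1 (hBu (x, y, t))
  have hvb1 := abs_le.1 (hBv (x', y', t'))
  have hpx0 : 0 ≤ A * ‖x - x'‖ ^ 2 := by positivity
  have hpy0 : 0 ≤ D * (y - y') ^ 2 := by positivity
  have hpt0 : 0 ≤ D * (t - t') ^ 2 := by positivity
  have hpenB : pen A D (x', y', t') (x, y, t) ≤ 2 * B := by linarith
  -- distances are at most r
  have hxr : ‖x - x'‖ ≤ r := by
    apply le_sq_aux _ hr.le
    have : A * ‖x - x'‖ ^ 2 ≤ A * r ^ 2 := by linarith
    exact le_of_mul_le_mul_left this hA0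
  have hxρ : ‖x - x'‖ ≤ ρ := by
    apply le_sq_aux _ hρ.le
    have : A * ‖x - x'‖ ^ 2 ≤ A * ρ ^ 2 := by linarith
    exact le_of_mul_le_mul_left this hA0
  have hyr : |y - y'| ≤ r := by
    apply abs_le_of_sq_le_sq _ hr.le
    have : D * (y - y') ^ 2 ≤ D * r ^ 2 := by linarith
    exact le_of_mul_le_mul_left this hD0
  have htr : |t - t'| ≤ r := by
    apply abs_le_of_sq_le_sq _ hr.le
    have : D * (t - t') ^ 2 ≤ D * r ^ 2 := by linarith
    exact le_of_mul_le_mul_left this hD0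
  have hcl := hclaim (x, y, t) (x', y', t')
    (by rw [Prod.norm_def, Prod.norm_def]; exact max_le hxR (max_le hyR htR))
    (by
      rw [Prod.dist_eq, Prod.dist_eq]
      simp only [dist_eq_norm, Real.norm_eq_abs]
      exact max_le hxr (max_le hyr htr))
  have hDy : D * |y - y'| ^ 2 ≤ η := by rw [sq_abs]; linarith
  have hDt : D * |t - t'| ^ 2 ≤ η := by rw [sq_abs]; linarith
  have hDη2 : η ≤ D * η ^ 2 := by
    have := mul_le_mul_of_nonneg_right hDη hη.le
    linarith
  have hyη : |y - y'| ≤ η :=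
    le_sq_aux (le_of_mul_le_mul_left (hDy.trans hDη2) hD0) hη.le
  have htη : |t - t'| ≤ η :=
    le_sq_aux (le_of_mul_le_mul_left (hDt.trans hDη2) hD0) hη.le
  -- bounds on G and p
  have hGlow : C₁ * ‖p‖ - C₂ - C₅ * |q| ≤ G x y t p q := by
    have a1 := hcoer x y t p
    have a2 := aux_H3q h1 h3 x y t p 0 q
    rw [sub_zero] at a2
    have := (abs_le.1 a2).1
    linarith
  have hαu1 : α * u (x, y, t) ≤ α * B := by gcongr; exact hub1.2
  have hαu2 : -(α * B) ≤ α * u (x, y, t) := by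
    have : α * (-B) ≤ α * u (x, y, t) := by gcongr; exact hub1.1
    linarith
  have hτ1 := abs_le.1 (le_refl |τ|)
  have hGup : G x y t p q ≤ |τ| + α * B := by linarith [hτ1.1]
  have hpR : ‖p‖ ≤ Rp := by
    rw [hRp, le_div_iff₀ hC1]
    have : C₅ * |q| ≤ C₅ * Rq := by gcongr
    linarith
  have hGabs : |G x y t p q| ≤ 2 * D * |t - t'| + C₅ * (2 * D * |y - y'|) + α * B + C₂ := by
    rw [← hqa, ← hτa]
    have e1 : 0 ≤ C₁ * ‖p‖ := by positivity
    have e2 : 0 ≤ C₅ * |q| := by positivity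
    have e3 : 0 ≤ α * B := by positivity
    have e4 := abs_nonneg τ
    rw [abs_le]
    constructor <;> linarith
  -- the three increments
  have i1 : G x' y' t' p q - G x y' t' p q ≤ η := by
    have e1 : ‖x'‖ ≤ R₁ := by
      have := norm_sub_norm_le x' x
      rw [norm_sub_rev] at this
      linarith
    have e2 : |y'| ≤ R₁ := by
      have := abs_sub_abs_le_abs_sub y' y
      rw [abs_sub_comm] at this
      linarith
    have e3 : |t'| ≤ R₁ := by
      have := abs_sub_abs_le_abs_sub t' t
      rw [abs_sub_comm] at this
      linarith
    apply hunif x x' y' t' p q _ _ _ _ _ _ hxρ <;> linarith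
  have i2 : G x y' t' p q - G x y t' p q ≤ C₃ * (2 * D * |y - y'| + |l|) * |y - y'| := by
    have := (le_abs_self _).trans (aux_H3y h1 h3 x y y' t' p q)
    rw [abs_sub_comm y' y] at this
    refine this.trans ?_
    rw [← hqa]
    gcongr
    exact abs_add_le _ _
  have i3 : G x y t' p q - G x y t p q ≤
      2 * C₄ * |t - t'| * (1 + 2 * D * |y - y'| + |G x y t p q|) := by
    have := (le_abs_self _).trans (aux_H3t h1 h3 x y t t' p q (by
      rw [abs_sub_comm]
      exact (mul_le_mul_of_nonneg_left htη hC4).trans hη2))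
    rw [abs_sub_comm t' t, hqa] at this
    exact this
  have hfin := final_arith (l := l) hC3 hC4 hC5 (by positivity : 0 ≤ α * B) hC2.le hη.le
    (abs_nonneg (y - y')) (abs_nonneg (t - t')) hyη htη hD0.le hDy hDt hGabs
  have hαM : α * M ≤ α * (u (x, y, t) - v (x', y', t')) := by
    gcongr
    linarith
  rw [hQ] at hη1
  linarith
end
end

section
/- Assume (H1)–(H3), let α > 0 and let w^α be a continuous space-time periodic viscosity solution of w^α_t + G(x,y,t,D_x w^α, D_y w^α) + α w^α = 0 on ℝⁿ×ℝ×ℝ. Set C₀ := sup_{x,y,t} |G(x,y,t,0,0)| and define w̄(x,t) := max_{y ∈ ℝ} w^α(x,y,t). Then w̄ is a continuous, ℤⁿ-periodic in x and 1-periodic in t, viscosity subsolution of w̄_t + C₁|D_x w̄| − (C₀ + C₂) = 0 on ℝⁿ×ℝ. -/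
open MeasureTheory Topology Filter
open scoped RealInnerProductSpace

noncomputable section

/-- A compact fundamental domain. -/
def fundK (n : ℕ) : Set (Dom n) :=
  ((WithLp.toLp 2 : (Fin n → ℝ) → Euc n) '' (Set.Icc 0 1)) ×ˢ (Set.Icc 0 1 ×ˢ Set.Icc 0 1)

lemma fundK_compact (n : ℕ) : IsCompact (fundK n) :=
  ((isCompact_Icc).image (PiLp.continuous_toLp 2 _)).prod (isCompact_Icc.prod isCompact_Icc)

lemma fundK_nonempty (n : ℕ) : (fundK n).Nonempty :=
  ⟨(WithLp.toLp 2 0, 0, 0), ⟨0, by simp, rfl⟩, by simp, by simp⟩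

lemma STPeriodic.exists_fundK {n : ℕ} {u : Dom n → ℝ} (hu : STPeriodic u) (z : Dom n) :
    ∃ z' ∈ fundK n, u z' = u z := by
  obtain ⟨x, y, t⟩ := z
  obtain ⟨hx, hy, ht⟩ := hu
  have hpy : Function.Periodic (fun y => u (x, y, t)) 1 := fun y => hy x y t
  obtain ⟨y', hy', ey⟩ := hpy.exists_mem_Ico₀ one_pos y
  have hpt : Function.Periodic (fun t => u (x, y', t)) 1 := fun t => ht x y' t
  obtain ⟨t', ht', et⟩ := hpt.exists_mem_Ico₀ one_pos t
  refine ⟨(WithLp.toLp 2 (fun i => Int.fract (x i)), y', t'), ⟨⟨_, ⟨?_, ?_⟩, rfl⟩,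
    ⟨hy'.1, hy'.2.le⟩, ⟨ht'.1, ht'.2.le⟩⟩, ?_⟩
  · intro i; exact Int.fract_nonneg _
  · intro i; exact (Int.fract_lt_one _).le
  · rw [← hx (fun i => ⌊x i⌋)]
    have : (WithLp.toLp 2 (fun i => Int.fract (x i)) : Euc n) + intVec (fun i => ⌊x i⌋) = x := by
      ext i
      simp [intVec, Int.fract_add_floor]
    rw [this]
    exact (ey.trans et).symm

lemma STPeriodic.exists_min {n : ℕ} {u : Dom n → ℝ} (hu : STPeriodic u) (hc : Continuous u) :
    ∃ z, ∀ z', u z ≤ u z' := by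
  obtain ⟨z, -, hz⟩ := (fundK_compact n).exists_isMinOn (fundK_nonempty n) hc.continuousOn
  refine ⟨z, fun z' => ?_⟩
  obtain ⟨z'', h, e⟩ := hu.exists_fundK z'
  rw [← e]; exact hz h

/-- Under (H1)–(H3), if w^α is a continuous space-time periodic
viscosity solution of `w_t + G + α w = 0` (α > 0), C₀ := sup |G(·,0,0)| and
`w̄(x,t) := max_y w^α(x,y,t)`, then w̄ is continuous, ℤⁿ-periodic in x, 1-periodic
in t, and a viscosity subsolution of `w̄_t + C₁|D_x w̄| - (C₀ + C₂) = 0` on ℝⁿ×ℝ. -/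
theorem statement6 {n : ℕ} (hn : 0 < n) (G : Ham n) (C₁ C₂ l C₃ C₄ C₅ : ℝ)
    (h1 : HypH1 G) (h2 : HypH2 G C₁ C₂) (h3 : HypH3 G l C₃ C₄ C₅)
    (α : ℝ) (hα : 0 < α) (w : Dom n → ℝ) (hper : STPeriodic w) (hsol : ViscSol G α 0 w)
    (C₀ : ℝ) (hC₀ : C₀ = sSup (Set.range fun p : Dom n => |G p.1 p.2.1 p.2.2 0 0|))
    (wbar : Dom2 n → ℝ)
    (hwbar : ∀ q : Dom2 n, wbar q = sSup (Set.range fun y : ℝ => w (q.1, y, q.2))) :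
    Continuous wbar ∧
    (∀ (k : Fin n → ℤ) (x : Euc n) (t : ℝ), wbar (x + intVec k, t) = wbar (x, t)) ∧
    (∀ x t, wbar (x, t + 1) = wbar (x, t)) ∧
    ViscSubEik C₁ (C₀ + C₂) wbar := by
  obtain ⟨hwc, hsub, hsup⟩ := hsol
  have hpy : ∀ q : Dom2 n, Function.Periodic (fun y => w (q.1, y, q.2)) 1 :=
    fun q y => hper.2.1 q.1 y q.2
  have hrange : ∀ q : Dom2 n, (Set.range fun y : ℝ => w (q.1, y, q.2)) =
      (fun y : ℝ => w (q.1, y, q.2)) '' Set.Icc 0 1 := by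
    intro q
    have := (hpy q).image_Icc one_pos 0
    rw [zero_add] at this
    exact this.symm
  -- the maximum over y is attained
  have hmax : ∀ q : Dom2 n, (∃ y, w (q.1, y, q.2) = wbar q) ∧ ∀ y, w (q.1, y, q.2) ≤ wbar q := by
    intro q
    have hcq : Continuous (fun y : ℝ => w (q.1, y, q.2)) := by fun_prop
    have hK : IsCompact (Set.range fun y : ℝ => w (q.1, y, q.2)) := by
      rw [hrange q]; exact isCompact_Icc.image hcq
    have hne := Set.range_nonempty (fun y : ℝ => w (q.1, y, q.2))
    rw [hwbar q]
    exact ⟨hK.sSup_mem hne, fun y => le_csSup hK.bddAbove ⟨y, rfl⟩⟩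
  have hcont : Continuous wbar := by
    have : wbar = fun q : Dom2 n => sSup ((fun y : ℝ => w (q.1, y, q.2)) '' Set.Icc 0 1) := by
      funext q; rw [hwbar q, hrange q]
    rw [this]
    refine IsCompact.continuous_sSup (f := fun (q : Dom2 n) (y : ℝ) => w (q.1, y, q.2))
      isCompact_Icc ?_
    simp only [Function.HasUncurry.uncurry, id]
    fun_prop
  -- lower bound on α w
  have hG0per : STPeriodic (fun p : Dom n => -|G p.1 p.2.1 p.2.2 0 0|) := by
    obtain ⟨-, a, b, c⟩ := h1
    exact ⟨fun k x y t => by simp only [a], fun x y t => by simp only [b],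
      fun x y t => by simp only [c]⟩
  have hG0c : Continuous (fun p : Dom n => -|G p.1 p.2.1 p.2.2 0 0|) := by
    have : Continuous (fun p : Dom n => ((p.1, p.2.1, p.2.2, 0, 0) : Xi n)) := by fun_prop
    exact (h1.1.comp this).abs.neg
  have hG0 : ∀ p : Dom n, |G p.1 p.2.1 p.2.2 0 0| ≤ C₀ := by
    obtain ⟨z, hz⟩ := hG0per.exists_min hG0c
    intro p
    rw [hC₀]
    refine le_csSup ⟨|G z.1 z.2.1 z.2.2 0 0|, ?_⟩ ⟨p, rfl⟩
    rintro _ ⟨q, rfl⟩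
    exact neg_le_neg_iff.1 (hz q)
  have hlow : ∀ z, -C₀ ≤ α * w z := by
    obtain ⟨z, hz⟩ := hper.exists_min hwc
    have := hsup.2 (fun _ => 0) contDiff_const z
      (Filter.Eventually.of_forall fun z' => by simpa using hz z')
    have e1 : pdT (fun _ : Dom n => (0 : ℝ)) z = 0 := by simp [pdT]
    have e2 : pdY (fun _ : Dom n => (0 : ℝ)) z = 0 := by simp [pdY]
    have e3 : pdX (fun _ : Dom n => (0 : ℝ)) z = 0 := by ext i; simp [pdX]
    rw [e1, e2, e3] at this
    intro z'
    have h4 := mul_le_mul_of_nonneg_left (hz z') hα.le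
    have h5 := (abs_le.1 (hG0 z)).2
    linarith
  refine ⟨hcont, ?_, ?_, hcont.upperSemicontinuous, ?_⟩
  · intro k x t
    rw [hwbar, hwbar]
    simp only [hper.1]
  · intro x t
    rw [hwbar, hwbar]
    simp only [hper.2.2]
  · intro φ hφ q hq
    obtain ⟨⟨y, hy⟩, -⟩ := hmax q
    let π : Dom n →L[ℝ] Dom2 n :=
      (ContinuousLinearMap.fst ℝ (Euc n) (ℝ × ℝ)).prod
        ((ContinuousLinearMap.snd ℝ ℝ ℝ).comp (ContinuousLinearMap.snd ℝ (Euc n) (ℝ × ℝ)))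
    have hπ : π (q.1, y, q.2) = q := rfl
    have hfd : fderiv ℝ (φ ∘ π) (q.1, y, q.2) = (fderiv ℝ φ q).comp π := by
      rw [fderiv_comp _ (by rw [hπ]; exact hφ.differentiable one_ne_zero q) π.differentiableAt,
        hπ, π.fderiv]
    have hloc : IsLocalMax (fun z => w z - (φ ∘ π) z) (q.1, y, q.2) := by
      have ht : Tendsto π (𝓝 (q.1, y, q.2)) (𝓝 q) := π.continuous.tendsto' _ _ hπ
      filter_upwards [ht.eventually hq] with z hz
      have h6 := (hmax (π z)).2 z.2.1
      have h7 : w z ≤ wbar (π z) := h6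
      simp only [Function.comp, hπ, hy]
      linarith
    have key := hsub.2 (φ ∘ π) (hφ.comp π.contDiff) _ hloc
    have e1 : pdT (φ ∘ π) (q.1, y, q.2) = pdT2 φ q := by
      rw [pdT, hfd]; rfl
    have e2 : pdY (φ ∘ π) (q.1, y, q.2) = 0 := by
      rw [pdY, hfd]; exact map_zero (fderiv ℝ φ q)
    have e3 : pdX (φ ∘ π) (q.1, y, q.2) = pdX2 φ q := by
      rw [pdX, hfd]; rfl
    rw [e1, e2, e3] at key
    have h8 := h2.2.2 q.1 y q.2 (pdX2 φ q)
    have h9 := hlow (q.1, y, q.2)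
    simp only at key
    linarith
end
end

section
/- Let C₁ > 0, C ≥ 0 and let w : ℝⁿ×ℝ → ℝ be a continuous function, ℤⁿ-periodic in x and 1-periodic in t, which is a viscosity subsolution of w_t + C₁|D_x w| − C = 0 on ℝⁿ×ℝ. Then there exists a constant K̄₁, depending only on n, C₁ and C (and not on w), such that max_{ℝⁿ×ℝ} w − min_{ℝⁿ×ℝ} w ≤ K̄₁. -/
open MeasureTheory Topology Filter
open scoped RealInnerProductSpace

noncomputable section

lemma hasFD {n : ℕ} (c A s : ℝ) (y v : Euc n) (q : Dom2 n) :
    HasFDerivAt (fun q : Dom2 n => c * (q.2 - s) + A * ‖q.1 - y - (q.2 - s) • v‖ ^ 2)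
      (c • ContinuousLinearMap.snd ℝ (Euc n) ℝ + A • (2 • (innerSL ℝ (q.1 - y - (q.2 - s) • v)).comp
        (ContinuousLinearMap.fst ℝ (Euc n) ℝ - (ContinuousLinearMap.snd ℝ (Euc n) ℝ).smulRight v))) q := by
  have h1 : HasFDerivAt (fun q : Dom2 n => q.1 - y - (q.2 - s) • v)
      (ContinuousLinearMap.fst ℝ (Euc n) ℝ - (ContinuousLinearMap.snd ℝ (Euc n) ℝ).smulRight v) q :=
    (hasFDerivAt_fst.sub_const y).sub ((hasFDerivAt_snd.sub_const s).smul_const v)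
  exact ((hasFDerivAt_snd.sub_const s).const_mul c).add (h1.norm_sq.const_mul A)

lemma test_ineq {n : ℕ} (C₁ c A s : ℝ) (hA : 0 ≤ A) (y v : Euc n) (hv : ‖v‖ ≤ C₁) (q : Dom2 n) :
    c ≤ pdT2 (fun q : Dom2 n => c * (q.2 - s) + A * ‖q.1 - y - (q.2 - s) • v‖ ^ 2) q +
      C₁ * ‖pdX2 (fun q : Dom2 n => c * (q.2 - s) + A * ‖q.1 - y - (q.2 - s) • v‖ ^ 2) q‖ := by
  unfold pdT2 pdX2
  rw [(hasFD c A s y v q).fderiv]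
  set ξ := q.1 - y - (q.2 - s) • v
  have hx : (WithLp.toLp 2 (fun i => (c • ContinuousLinearMap.snd ℝ (Euc n) ℝ + A • (2 • (innerSL ℝ ξ).comp
        (ContinuousLinearMap.fst ℝ (Euc n) ℝ - (ContinuousLinearMap.snd ℝ (Euc n) ℝ).smulRight v)))
        (EuclideanSpace.single i (1:ℝ), 0)) : Euc n) = (2 * A) • ξ := by
    ext i
    simp [EuclideanSpace.inner_single_right]
    ring
  rw [hx, norm_smul, Real.norm_of_nonneg (by positivity)]
  have h1 : (c • ContinuousLinearMap.snd ℝ (Euc n) ℝ + A • (2 • (innerSL ℝ ξ).comp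
        (ContinuousLinearMap.fst ℝ (Euc n) ℝ - (ContinuousLinearMap.snd ℝ (Euc n) ℝ).smulRight v)))
        ((0 : Euc n), (1:ℝ)) = c - 2 * A * inner ℝ ξ v := by
    simp
    ring
  rw [h1]
  have h2 : inner ℝ ξ v ≤ ‖ξ‖ * C₁ :=
    (real_inner_le_norm ξ v).trans (mul_le_mul_of_nonneg_left hv (norm_nonneg _))
  nlinarith [mul_le_mul_of_nonneg_left h2 (by positivity : 0 ≤ 2 * A)]

lemma key {n : ℕ} (C₁ C : ℝ) (w : Dom2 n → ℝ) (hw : Continuous w) (M : ℝ)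
    (hM : ∀ q, |w q| ≤ M) (hsub : ViscSubEik C₁ C w) (c : ℝ) (hc : 0 < c) (hCc : C < c)
    (y v : Euc n) (hv : ‖v‖ ≤ C₁) (s t : ℝ) (hst : s ≤ t) :
    w (y + (t - s) • v, t) - w (y, s) ≤ c * (t - s) := by
  by_contra! hcon
  have hM0 : 0 ≤ M := (abs_nonneg _).trans (hM (y, s))
  obtain ⟨r, hr, hrw⟩ : ∃ r > 0, ∀ x : Euc n, dist x y < r →
      w (x, s) < w (y + (t - s) • v, t) - c * (t - s) := by
    have h1 : ContinuousAt (fun x : Euc n => w (x, s)) y := by fun_prop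
    have h2 := h1.eventually (gt_mem_nhds (show w (y, s) < w (y + (t - s) • v, t) - c * (t - s) by linarith))
    exact Metric.eventually_nhds_iff.1 h2
  set A : ℝ := (2 * M + 1) / r ^ 2 with hAdef
  have hA : 0 < A := by positivity
  have hAr : A * r ^ 2 = 2 * M + 1 := by rw [hAdef]; field_simp
  set φ : Dom2 n → ℝ := fun q => c * (q.2 - s) + A * ‖q.1 - y - (q.2 - s) • v‖ ^ 2 with hφ
  have hφs : ContDiff ℝ 1 φ := by
    have : ContDiff ℝ 1 (fun q : Dom2 n => q.1 - y - (q.2 - s) • v) := by fun_prop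
    exact (by fun_prop : ContDiff ℝ 1 fun q : Dom2 n => c * (q.2 - s)).add
      (contDiff_const.mul (this.norm_sq ℝ))
  set T : ℝ := s + 2 * M / c with hT
  have hcT : c * (T - s) = 2 * M := by rw [hT]; field_simp; ring
  set p₀ : Dom2 n := (y + (t - s) • v, t) with hp₀
  have hH0 : w p₀ - φ p₀ = w p₀ - c * (t - s) := by simp [hφ, hp₀]
  have hys := abs_le.1 (hM (y, s))
  set K : Set (Dom2 n) := (fun q : Dom2 n => (q.1 + y + (q.2 - s) • v, q.2)) ''
    (Metric.closedBall (0 : Euc n) r ×ˢ Set.Icc s T) with hK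
  have hKc : IsCompact K :=
    ((isCompact_closedBall _ _).prod isCompact_Icc).image (by fun_prop)
  have hout : ∀ q : Dom2 n, s ≤ q.2 → q ∉ K → w q - φ q < w p₀ - φ p₀ := by
    intro q hq hqK
    rw [hH0]
    have hwq := abs_le.1 (hM q)
    have hpos : 0 ≤ A * ‖q.1 - y - (q.2 - s) • v‖ ^ 2 := by positivity
    have hpos2 : 0 ≤ c * (q.2 - s) := mul_nonneg hc.le (by linarith)
    have : 2 * M ≤ φ q := by
      by_contra! hlt
      apply hqK
      refine ⟨(q.1 - y - (q.2 - s) • v, q.2), ⟨?_, hq, ?_⟩, ?_⟩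
      · rw [mem_closedBall_zero_iff]
        by_contra! h
        have h' : A * r ^ 2 ≤ A * ‖q.1 - y - (q.2 - s) • v‖ ^ 2 := by
          have h3 : r ≤ ‖q.1 - y - (q.2 - s) • v‖ := h.le
          gcongr
        simp only [hφ] at hlt
        linarith
      · by_contra! h
        have h' : c * (T - s) ≤ c * (q.2 - s) := by
          have h3 : T ≤ q.2 := h.le
          gcongr
        simp only [hφ] at hlt
        linarith
      · refine Prod.ext ?_ rfl
        change q.1 - y - (q.2 - s) • v + y + (q.2 - s) • v = q.1
        abel
    linarith
  have hp₀K : p₀ ∈ K := by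
    by_contra h
    exact lt_irrefl _ (hout p₀ hst h)
  obtain ⟨p, hpK, hpmax⟩ := hKc.exists_isMaxOn ⟨p₀, hp₀K⟩
    (hw.sub hφs.continuous).continuousOn
  have hmax : ∀ q : Dom2 n, s ≤ q.2 → w q - φ q ≤ w p - φ p := by
    intro q hq
    by_cases h : q ∈ K
    · exact hpmax h
    · exact (hout q hq h).le.trans (hpmax hp₀K)
  have hps : s ≤ p.2 := by
    obtain ⟨q, hq, rfl⟩ := hpK
    exact hq.2.1
  have hne : s ≠ p.2 := by
    intro h
    have h0 : w p₀ - φ p₀ ≤ w p - φ p := hpmax hp₀K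
    rw [hH0] at h0
    have hp : p = (p.1, s) := by rw [h]
    have hφp : φ p = A * ‖p.1 - y‖ ^ 2 := by simp [hφ, ← h]
    by_cases hd : dist p.1 y < r
    · have h1 := hrw _ hd
      rw [← hp] at h1
      have : 0 ≤ φ p := by rw [hφp]; positivity
      linarith
    · push Not at hd
      rw [dist_eq_norm] at hd
      have h' : A * r ^ 2 ≤ A * ‖p.1 - y‖ ^ 2 := by gcongr
      have hwq := abs_le.1 (hM p)
      linarith
  have hlt : s < p.2 := lt_of_le_of_ne hps hne
  have hloc : IsLocalMax (fun q => w q - φ q) p := by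
    filter_upwards [continuous_snd.continuousAt.eventually (lt_mem_nhds hlt)] with q hq
    exact hmax q (le_of_lt hq)
  have h1 := hsub.2 φ hφs p hloc
  have h2 := test_ineq C₁ c A s hA.le y v hv p
  linarith

lemma per_t {n : ℕ} (w : Dom2 n → ℝ) (h : ∀ (x : Euc n) (t : ℝ), w (x, t + 1) = w (x, t))
    (x : Euc n) (t : ℝ) (m : ℤ) : w (x, t + m) = w (x, t) := by
  have : Function.Periodic (fun t => w (x, t)) 1 := fun t => h x t
  simpa using this.int_mul m t

lemma norm_le_sqrt {n : ℕ} (x : Euc n) (h : ∀ i, |x i| ≤ 1) : ‖x‖ ≤ √n := by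
  rw [EuclideanSpace.norm_eq]
  apply Real.sqrt_le_sqrt
  calc ∑ i, ‖x i‖ ^ 2 ≤ ∑ i : Fin n, (1:ℝ) := by
        apply Finset.sum_le_sum
        intro i _
        have := h i
        rw [Real.norm_eq_abs]
        exact pow_le_one₀ (abs_nonneg _) this
    _ = n := by simp

lemma shift_x {n : ℕ} (x y : Euc n) : ∃ k : Fin n → ℤ, ‖x + intVec k - y‖ ≤ √n := by
  refine ⟨fun i => -⌊x i - y i⌋, norm_le_sqrt _ fun i => ?_⟩
  have h : (x + intVec (fun i => -⌊x i - y i⌋) - y) i = Int.fract (x i - y i) := by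
    rw [← Int.self_sub_floor]
    simp only [intVec, PiLp.add_apply, PiLp.sub_apply]
    push_cast
    ring
  rw [h, abs_of_nonneg (Int.fract_nonneg _)]
  exact (Int.fract_lt_one _).le

lemma bdd_w {n : ℕ} (w : Dom2 n → ℝ) (hw : Continuous w)
    (hx : ∀ (k : Fin n → ℤ) (x : Euc n) (t : ℝ), w (x + intVec k, t) = w (x, t))
    (ht : ∀ (x : Euc n) (t : ℝ), w (x, t + 1) = w (x, t)) : ∃ M, ∀ q, |w q| ≤ M := by
  obtain ⟨M, hM⟩ := ((isCompact_closedBall (0 : Euc n) (√n)).prod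
    (isCompact_Icc (a := (0:ℝ)) (b := 1))).exists_bound_of_continuousOn hw.continuousOn
  refine ⟨M, fun q => ?_⟩
  obtain ⟨k, hk⟩ := shift_x q.1 0
  have h1 := hM (q.1 + intVec k, q.2 + ((-⌊q.2⌋ : ℤ) : ℝ)) ⟨by simpa using hk, ?_⟩
  · rwa [per_t w ht, hx] at h1
  · have := Int.fract_nonneg q.2
    have := (Int.fract_lt_one q.2).le
    unfold Int.fract at *
    constructor <;> push_cast <;> linarith

/-- There is a constant K̄₁ depending only on n, C₁ and C such that
every continuous, ℤⁿ-periodic in x and 1-periodic in t, viscosity subsolution of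
`w_t + C₁|D_x w| - C = 0` on ℝⁿ×ℝ (C₁ > 0, C ≥ 0) has oscillation at most K̄₁. -/
theorem statement8 {n : ℕ} (hn : 0 < n) (C₁ C : ℝ) (hC₁ : 0 < C₁) (hC : 0 ≤ C) :
    ∃ K : ℝ, ∀ w : Dom2 n → ℝ, Continuous w →
      (∀ (k : Fin n → ℤ) (x : Euc n) (t : ℝ), w (x + intVec k, t) = w (x, t)) →
      (∀ (x : Euc n) (t : ℝ), w (x, t + 1) = w (x, t)) →
      ViscSubEik C₁ C w →
      ∀ z z' : Dom2 n, w z - w z' ≤ K := by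
  refine ⟨(C + 1) * (√n / C₁ + 1), fun w hw hx ht hsub z z' => ?_⟩
  obtain ⟨M, hM⟩ := bdd_w w hw hx ht
  obtain ⟨x, t⟩ := z
  obtain ⟨y, s⟩ := z'
  obtain ⟨k, hk⟩ := shift_x x y
  set T := √n / C₁ with hT
  have hn' : (0:ℝ) < n := by exact_mod_cast hn
  have hTpos : 0 < T := by positivity
  set m : ℤ := ⌈s + T - t⌉
  have hm1 : s + T - t ≤ m := Int.le_ceil _
  have hm2 : (m : ℝ) < s + T - t + 1 := Int.ceil_lt_add_one _
  set t' : ℝ := t + m with ht'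
  have hd : 0 < t' - s := by linarith
  have hv : ‖(t' - s)⁻¹ • (x + intVec k - y)‖ ≤ C₁ := by
    rw [norm_smul, norm_inv, Real.norm_of_nonneg hd.le, inv_mul_le_iff₀ hd]
    have : √n = T * C₁ := by rw [hT]; field_simp
    have h2 : T * C₁ ≤ (t' - s) * C₁ := mul_le_mul_of_nonneg_right (by linarith) hC₁.le
    linarith
  have h := key C₁ C w hw M hM hsub (C + 1) (by linarith) (by linarith) y _ hv s t' (by linarith)
  rw [smul_inv_smul₀ hd.ne', add_sub_cancel, hx, ht', per_t w ht] at h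
  have h3 : (C + 1) * (t' - s) ≤ (C + 1) * (T + 1) :=
    mul_le_mul_of_nonneg_left (by linarith) (by linarith)
  linarith
end
end

section
/- Assume (H1)–(H3), and for each α > 0 let w^α be the unique continuous space-time periodic viscosity solution of w^α_t + G(x,y,t,D_x w^α, D_y w^α) + α w^α = 0 on ℝⁿ×ℝ×ℝ. Then the functions −α w^α converge uniformly on ℝⁿ×ℝ×ℝ, as α → 0⁺, to the ergodic constant λ̄. -/
open MeasureTheory Topology Filter
open scoped RealInnerProductSpace

noncomputable section

/-- An a.e. derivative bound on an interval gives an increment bound for a locally Lipschitz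
function. -/
lemma abs_sub_le_of_ae_deriv {f : ℝ → ℝ} (hf : LocallyLipschitz f) {C a b : ℝ}
    (h : ∀ᵐ s, s ∈ Set.uIcc a b → |deriv f s| ≤ C) : |f b - f a| ≤ C * |b - a| := by
  obtain ⟨K, hK⟩ := (hf.locallyLipschitzOn (s := Set.uIcc a b)).exists_lipschitzOnWith_of_compact
    isCompact_uIcc
  rw [← hK.absolutelyContinuousOnInterval.integral_deriv_eq_sub]
  rw [← Real.norm_eq_abs]
  refine intervalIntegral.norm_integral_le_of_norm_le_const_ae (f := deriv f) ?_
  filter_upwards [h] with s hs hs'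
  exact hs (Set.uIoc_subset_uIcc hs')

lemma forall_of_ae_closed {X : Type*} [TopologicalSpace X] [MeasurableSpace X] {μ : Measure X}
    [μ.IsOpenPosMeasure] {p : X → Prop} (hc : IsClosed {x | p x}) (h : ∀ᵐ x ∂μ, p x) :
    ∀ x, p x := by
  intro x
  have := (μ.dense_of_ae h) x
  rwa [hc.closure_eq] at this

lemma ae_swap {A B : Type*} [MeasureSpace A] [MeasureSpace B]
    [SFinite (volume : Measure A)] [SFinite (volume : Measure B)] {p : A × B → Prop}
    (h : ∀ᵐ z : A × B, p z) : ∀ᵐ b : B, ∀ᵐ a : A, p (a, b) := by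
  have h' : ∀ᵐ z : B × A, p z.swap :=
    (Measure.measurePreserving_swap (μ := (volume : Measure B))
      (ν := (volume : Measure A))).quasiMeasurePreserving.ae h
  exact Measure.ae_ae_of_ae_prod h'

section reg
variable {n : ℕ} {G : Ham n} {l C₃ C₄ C₅ : ℝ}

lemma HypH1.cont (h1 : HypH1 G) {X : Type*} [TopologicalSpace X] {a : X → Euc n} {b c : X → ℝ}
    {d : X → Euc n} {e : X → ℝ} (ha : Continuous a) (hb : Continuous b) (hc : Continuous c)
    (hd : Continuous d) (he : Continuous e) :
    Continuous (fun s => G (a s) (b s) (c s) (d s) (e s)) :=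
  h1.1.comp (ha.prodMk (hb.prodMk (hc.prodMk (hd.prodMk he))))

lemma reg_y (h1 : HypH1 G) (h3 : HypH3 G l C₃ C₄ C₅) (x : Euc n) (t : ℝ) (px : Euc n) (py : ℝ)
    (y y' : ℝ) : |G x y' t px py - G x y t px py| ≤ C₃ * |py + l| * |y' - y| := by
  obtain ⟨h30, h40, h50, hL, hae⟩ := h3
  have key : ∀ x : Euc n, ∀ r : ℝ × Euc n × ℝ,
      |G x y' r.1 r.2.1 r.2.2 - G x y r.1 r.2.1 r.2.2| ≤ C₃ * |r.2.2 + l| * |y' - y| := by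
    refine forall_of_ae_closed (μ := volume) ?_ ?_
    · simp only [Set.ofPred_forall]
      refine isClosed_iInter fun r => isClosed_le ?_ continuous_const
      exact ((h1.cont (by fun_prop) (by fun_prop) (by fun_prop) (by fun_prop) (by fun_prop)).sub
        (h1.cont (by fun_prop) (by fun_prop) (by fun_prop) (by fun_prop) (by fun_prop))).abs
    filter_upwards [Measure.ae_ae_of_ae_prod hae] with x hx
    refine forall_of_ae_closed (μ := volume) ?_ ?_
    · refine isClosed_le ?_ (by fun_prop)
      exact ((h1.cont (by fun_prop) (by fun_prop) (by fun_prop) (by fun_prop) (by fun_prop)).sub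
        (h1.cont (by fun_prop) (by fun_prop) (by fun_prop) (by fun_prop) (by fun_prop))).abs
    filter_upwards [ae_swap hx] with r hr
    refine abs_sub_le_of_ae_deriv (f := fun y => G x y r.1 r.2.1 r.2.2) ?_ ?_
    · exact (hL x r.2.1).comp (g := fun y : ℝ => (y, r.1, r.2.2))
        (LipschitzWith.prodMk_right _).locallyLipschitz
    · filter_upwards [hr] with s hs _
      exact hs.1
  exact key x (t, px, py)

lemma reg_p (h1 : HypH1 G) (h3 : HypH3 G l C₃ C₄ C₅) (x : Euc n) (y t : ℝ) (px : Euc n)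
    (py py' : ℝ) : |G x y t px py' - G x y t px py| ≤ C₅ * |py' - py| := by
  obtain ⟨h30, h40, h50, hL, hae⟩ := h3
  have hc : ∀ {X : Type} [TopologicalSpace X] {a : X → Euc n} {b c : X → ℝ}
    {d : X → Euc n} (ha : Continuous a) (hb : Continuous b) (hc : Continuous c)
    (hd : Continuous d), 
    IsClosed {s | |G (a s) (b s) (c s) (d s) py' - G (a s) (b s) (c s) (d s) py|
      ≤ C₅ * |py' - py|} := by
    intro X _ a b c d ha hb hc hd
    refine isClosed_le ?_ continuous_const
    exact ((h1.cont ha hb hc hd continuous_const).sub (h1.cont ha hb hc hd continuous_const)).abs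
  have key : ∀ x : Euc n, ∀ y t : ℝ, ∀ px : Euc n,
      |G x y t px py' - G x y t px py| ≤ C₅ * |py' - py| := by
    refine forall_of_ae_closed (μ := volume) ?_ ?_
    · simp only [Set.ofPred_forall]
      exact isClosed_iInter fun y => isClosed_iInter fun t => isClosed_iInter fun px =>
        hc (by fun_prop) (by fun_prop) (by fun_prop) (by fun_prop)
    filter_upwards [Measure.ae_ae_of_ae_prod hae] with x hx
    refine forall_of_ae_closed (μ := volume) ?_ ?_
    · simp only [Set.ofPred_forall]
      exact isClosed_iInter fun t => isClosed_iInter fun px =>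
        hc (by fun_prop) (by fun_prop) (by fun_prop) (by fun_prop)
    filter_upwards [Measure.ae_ae_of_ae_prod hx] with y hy
    refine forall_of_ae_closed (μ := volume) ?_ ?_
    · simp only [Set.ofPred_forall]
      exact isClosed_iInter fun px =>
        hc (by fun_prop) (by fun_prop) (by fun_prop) (by fun_prop)
    filter_upwards [Measure.ae_ae_of_ae_prod hy] with t ht
    refine forall_of_ae_closed (μ := volume) ?_ ?_
    · exact hc (by fun_prop) (by fun_prop) (by fun_prop) (by fun_prop)
    filter_upwards [Measure.ae_ae_of_ae_prod ht] with px hpx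
    refine abs_sub_le_of_ae_deriv (f := fun py => G x y t px py) ?_ ?_
    · exact (hL x px).comp (g := fun q : ℝ => (y, t, q))
        ((LipschitzWith.prodMk_left y).comp (LipschitzWith.prodMk_left t)).locallyLipschitz
    · filter_upwards [hpx] with s hs _
      exact hs.2.2
  exact key x y t px

lemma reg_t_aux {f : ℝ → ℝ} (hf : LocallyLipschitz f) {C P a b : ℝ} (hC : 0 ≤ C) (hP : 0 ≤ P)
    (h : ∀ᵐ s, |deriv f s| ≤ C * (P + |f s|)) (hab : C * |b - a| ≤ 1 / 2) :
    |f b - f a| ≤ 2 * C * |b - a| * (P + |f a|) := by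
  obtain ⟨m, hm, hmax⟩ := (isCompact_uIcc (a := a) (b := b)).exists_isMaxOn
    (f := fun s => |f s|) ⟨a, Set.left_mem_uIcc⟩ hf.continuous.abs.continuousOn
  have hmax' : ∀ s ∈ Set.uIcc a b, |f s| ≤ |f m| := fun s hs => hmax hs
  have step : ∀ c ∈ Set.uIcc a b, |f c - f a| ≤ C * (P + |f m|) * |c - a| := by
    intro c hc
    refine abs_sub_le_of_ae_deriv hf ?_
    filter_upwards [h] with s hs hs'
    refine hs.trans ?_
    have := hmax' s (Set.uIcc_subset_uIcc Set.left_mem_uIcc hc hs')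
    gcongr
  have e1 := step m hm
  have e2 := step b Set.right_mem_uIcc
  have hma : |m - a| ≤ |b - a| := Set.abs_sub_left_of_mem_uIcc hm
  have h0 := abs_nonneg (f m)
  have e3 : C * (P + |f m|) * |m - a| ≤ (P + |f m|) * (1/2) := by
    calc C * (P + |f m|) * |m - a| ≤ C * (P + |f m|) * |b - a| := by gcongr
      _ = (P + |f m|) * (C * |b - a|) := by ring
      _ ≤ _ := by gcongr
  have e4 : |f m| ≤ |f a| + |f m - f a| := by
    have := abs_add_le (f a) (f m - f a)
    simpa using this
  have e5 : P + |f m| ≤ 2 * (P + |f a|) := by linarith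
  calc _ ≤ _ := e2
    _ ≤ C * (2 * (P + |f a|)) * |b - a| := by gcongr
    _ = _ := by ring

lemma reg_t (h1 : HypH1 G) (h3 : HypH3 G l C₃ C₄ C₅) (x : Euc n) (y : ℝ) (px : Euc n) (py : ℝ)
    (t t' : ℝ) (ht : C₄ * |t' - t| ≤ 1 / 2) : |G x y t' px py - G x y t px py| ≤
      2 * C₄ * |t' - t| * (1 + |py| + |G x y t px py|) := by
  obtain ⟨h30, h40, h50, hL, hae⟩ := h3
  have hc : ∀ {X : Type} [TopologicalSpace X] {a : X → Euc n} {b : X → ℝ}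
    {d : X → Euc n} {e : X → ℝ} (ha : Continuous a) (hb : Continuous b)
    (hd : Continuous d) (he : Continuous e),
    IsClosed {s | |G (a s) (b s) t' (d s) (e s) - G (a s) (b s) t (d s) (e s)| ≤
      2 * C₄ * |t' - t| * (1 + |e s| + |G (a s) (b s) t (d s) (e s)|)} := by
    intro X _ a b d e ha hb hd he
    have k1 := h1.cont (c := fun _ => t) ha hb continuous_const hd he
    have k2 := h1.cont (c := fun _ => t') ha hb continuous_const hd he
    exact isClosed_le (k2.sub k1).abs
      (continuous_const.mul ((continuous_const.add he.abs).add k1.abs))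
  have key : ∀ x : Euc n, ∀ y : ℝ, ∀ r : Euc n × ℝ,
      |G x y t' r.1 r.2 - G x y t r.1 r.2| ≤
        2 * C₄ * |t' - t| * (1 + |r.2| + |G x y t r.1 r.2|) := by
    refine forall_of_ae_closed (μ := volume) ?_ ?_
    · simp only [Set.ofPred_forall]
      exact isClosed_iInter fun y => isClosed_iInter fun r =>
        hc (by fun_prop) (by fun_prop) (by fun_prop) (by fun_prop)
    filter_upwards [Measure.ae_ae_of_ae_prod hae] with x hx
    refine forall_of_ae_closed (μ := volume) ?_ ?_
    · simp only [Set.ofPred_forall]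
      exact isClosed_iInter fun r =>
        hc (by fun_prop) (by fun_prop) (by fun_prop) (by fun_prop)
    filter_upwards [Measure.ae_ae_of_ae_prod hx] with y hy
    refine forall_of_ae_closed (μ := volume) ?_ ?_
    · exact hc (by fun_prop) (by fun_prop) (by fun_prop) (by fun_prop)
    filter_upwards [ae_swap hy] with r hr
    refine reg_t_aux (f := fun t => G x y t r.1 r.2) ?_ h40 (by positivity) ?_ ht
    · exact (hL x r.1).comp (g := fun q : ℝ => (y, q, r.2))
        ((LipschitzWith.prodMk_left y).comp (LipschitzWith.prodMk_right r.2)).locallyLipschitz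
    · filter_upwards [hr] with s hs
      exact hs.2.1
  exact key x y (px, py)

end reg

section per
variable {n : ℕ} {G : Ham n}

lemma exists_shift (x : Euc n) : ∃ k : Fin n → ℤ, ‖x + intVec k‖ ≤ n := by
  refine ⟨fun i => -⌊x i⌋, ?_⟩
  rw [EuclideanSpace.norm_eq]
  have h : ∀ i, ‖(x + intVec (fun i => -⌊x i⌋)) i‖ ^ 2 ≤ 1 := by
    intro i
    have : (x + intVec (fun i => -⌊x i⌋)) i = Int.fract (x i) := by
      simp [intVec, Int.fract, sub_eq_add_neg]
    rw [this, Real.norm_eq_abs, sq_abs]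
    have h0 := Int.fract_nonneg (x i)
    have h1 := Int.fract_lt_one (x i)
    nlinarith
  have h2 : ∑ i, ‖(x + intVec (fun i => -⌊x i⌋)) i‖ ^ 2 ≤ (n : ℝ) := by
    calc _ ≤ ∑ _i : Fin n, (1 : ℝ) := Finset.sum_le_sum fun i _ => h i
      _ = n := by simp
  refine Real.sqrt_le_iff.2 ⟨by positivity, h2.trans ?_⟩
  rcases Nat.eq_zero_or_pos n with h0 | h0
  · simp [h0]
  · have : (1 : ℝ) ≤ n := by exact_mod_cast h0
    nlinarith

lemma per_fract {f : ℝ → ℝ} (hf : ∀ y, f (y + 1) = f y) (y : ℝ) : f (Int.fract y) = f y := by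
  have : Function.Periodic f 1 := hf
  have h := this.sub_int_mul_eq (x := y) ⌊y⌋
  rw [mul_one] at h
  exact h

lemma bdd_of_periodic {w : Dom n → ℝ} (hp : STPeriodic w) (hc : Continuous w) : Bdd w := by
  have hK : IsCompact ((Metric.closedBall (0 : Euc n) n) ×ˢ
      (Set.Icc (0:ℝ) 1 ×ˢ Set.Icc (0:ℝ) 1)) :=
    (isCompact_closedBall _ _).prod (isCompact_Icc.prod isCompact_Icc)
  obtain ⟨M, hM⟩ := hK.exists_bound_of_continuousOn hc.continuousOn
  refine ⟨M, fun ⟨x, y, t⟩ => ?_⟩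
  obtain ⟨k, hk⟩ := exists_shift x
  have e : w (x, y, t) = w (x + intVec k, Int.fract y, Int.fract t) := by
    rw [hp.1, per_fract (f := fun t => w (x, Int.fract y, t)) (hp.2.2 _ _),
      per_fract (f := fun y => w (x, y, t)) (fun y => hp.2.1 _ _ _)]
  rw [e]
  exact hM _ ⟨by simpa using hk, ⟨Int.fract_nonneg _, (Int.fract_lt_one _).le⟩,
    ⟨Int.fract_nonneg _, (Int.fract_lt_one _).le⟩⟩

lemma unif_G (h1 : HypH1 G) (R : ℝ) {θ : ℝ} (hθ : 0 < θ) : ∃ r > 0, ∀ (x x' : Euc n) (y t : ℝ)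
    (p p' : Euc n) (q q' : ℝ), ‖p‖ ≤ R → ‖p'‖ ≤ R → |q| ≤ R → |q'| ≤ R → ‖x - x'‖ ≤ r →
    ‖p - p'‖ ≤ r → |q - q'| ≤ r → |G x y t p q - G x' y t p' q'| ≤ θ := by
  have hK : IsCompact ((Metric.closedBall (0 : Euc n) (n + 1)) ×ˢ
      (Set.Icc (0:ℝ) 1 ×ˢ (Set.Icc (0:ℝ) 1 ×ˢ (Metric.closedBall (0 : Euc n) R ×ˢ
        Metric.closedBall (0 : ℝ) R)))) :=
    (isCompact_closedBall _ _).prod (isCompact_Icc.prod (isCompact_Icc.prod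
      ((isCompact_closedBall _ _).prod (isCompact_closedBall _ _))))
  have hu := hK.uniformContinuousOn_of_continuous h1.1.continuousOn
  rw [Metric.uniformContinuousOn_iff] at hu
  obtain ⟨δ, hδ, hu⟩ := hu θ hθ
  refine ⟨min 1 (δ / 2), by positivity, ?_⟩
  intro x x' y t p p' q q' hp hp' hq hq' hx hpp hqq
  obtain ⟨k, hk⟩ := exists_shift x
  have e : ∀ x p q, G x y t p q = G (x + intVec k) (Int.fract y) (Int.fract t) p q := by
    intro x p q
    rw [h1.2.1, per_fract (f := fun t => G x (Int.fract y) t p q) (fun t => h1.2.2.2 _ _ _ _ _),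
      per_fract (f := fun y => G x y t p q) (fun y => h1.2.2.1 _ _ _ _ _)]
  rw [e x, e x']
  have hy : Int.fract y ∈ Set.Icc (0:ℝ) 1 := ⟨Int.fract_nonneg _, (Int.fract_lt_one _).le⟩
  have ht : Int.fract t ∈ Set.Icc (0:ℝ) 1 := ⟨Int.fract_nonneg _, (Int.fract_lt_one _).le⟩
  have hx1 := hx.trans (min_le_left _ _)
  have hx2 := hx.trans (min_le_right _ _)
  have hp2 := hpp.trans (min_le_right _ _)
  have hq2 := hqq.trans (min_le_right _ _)
  have hk' : ‖x' + intVec k‖ ≤ n + 1 := by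
    have : x' + intVec k = (x + intVec k) - (x - x') := by abel
    rw [this]
    exact (norm_sub_le _ _).trans (add_le_add hk hx1)
  have := hu (x + intVec k, Int.fract y, Int.fract t, p, q)
    ⟨by simpa using hk.trans (by linarith), hy, ht, by simpa using hp, by simpa using hq⟩
    (x' + intVec k, Int.fract y, Int.fract t, p', q')
    ⟨by simpa using hk', hy, ht, by simpa using hp', by simpa using hq'⟩ ?_
  · rw [Real.dist_eq] at this
    exact this.le
  · rw [Prod.dist_eq, Prod.dist_eq, Prod.dist_eq, Prod.dist_eq]
    simp only [max_lt_iff]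
    refine ⟨?_, by simpa using hδ, by simpa using hδ, ?_, ?_⟩
    · rw [dist_add_right, dist_eq_norm]; linarith
    · rw [dist_eq_norm]; linarith
    · rw [Real.dist_eq]; linarith

/-- Quadratic test functions. -/
def quad (a b δ : ℝ) (c d : Dom n) (z : Dom n) : ℝ :=
  a * ‖z.1 - c.1‖ ^ 2 + b * ((z.2.1 - c.2.1) ^ 2 + (z.2.2 - c.2.2) ^ 2) +
    δ * (‖z.1 - d.1‖ ^ 2 + (z.2.1 - d.2.1) ^ 2 + (z.2.2 - d.2.2) ^ 2)

lemma quad_contDiff (a b δ : ℝ) (c d : Dom n) : ContDiff ℝ 1 (quad a b δ c d) := by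
  have h : ∀ e : Dom n, ContDiff ℝ 1 (fun z : Dom n => ‖z.1 - e.1‖ ^ 2) := fun e =>
    (contDiff_fst.sub contDiff_const).norm_sq ℝ
  have h1 := h c
  have h2 := h d
  unfold quad
  fun_prop

lemma quad_fderiv (a b δ : ℝ) (c d : Dom n) (z v : Dom n) :
    fderiv ℝ (quad a b δ c d) z v =
      a * (2 * inner ℝ (z.1 - c.1) v.1) +
      b * (2 * (z.2.1 - c.2.1) * v.2.1 + 2 * (z.2.2 - c.2.2) * v.2.2) +
      δ * (2 * inner ℝ (z.1 - d.1) v.1 + 2 * (z.2.1 - d.2.1) * v.2.1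
        + 2 * (z.2.2 - d.2.2) * v.2.2) := by
  have hd : DifferentiableAt ℝ (quad a b δ c d) z :=
    (quad_contDiff a b δ c d).differentiable (by norm_num) z
  have hline : HasDerivAt (fun s : ℝ => z + s • v) v 0 := by
    simpa using ((hasDerivAt_id (0:ℝ)).smul_const v).const_add z
  have hd' : HasFDerivAt (quad a b δ c d) (fderiv ℝ (quad a b δ c d) z) (z + (0:ℝ) • v) := by
    simpa using hd.hasFDerivAt
  have h1 := hd'.comp_hasDerivAt (0:ℝ) hline
  have hx : ∀ e : Euc n, HasDerivAt (fun s : ℝ => ‖z.1 + s • v.1 - e‖ ^ 2)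
      (2 * inner ℝ (z.1 - e) v.1) 0 := by
    intro e
    have : HasDerivAt (fun s : ℝ => z.1 + s • v.1 - e) v.1 0 := by
      simpa using (((hasDerivAt_id (0:ℝ)).smul_const v.1).const_add z.1).sub_const e
    simpa using this.norm_sq
  have hy : ∀ p q e : ℝ, HasDerivAt (fun s : ℝ => (p + s * q - e) ^ 2)
      (2 * (p - e) * q) 0 := by
    intro p q e
    have : HasDerivAt (fun s : ℝ => p + s * q - e) q 0 := by
      simpa using (((hasDerivAt_id (0:ℝ)).mul_const q).const_add p).sub_const e
    have h := this.pow 2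
    simp only [zero_mul, add_zero, Nat.cast_ofNat, Nat.add_one_sub_one, pow_one] at h
    exact h
  have h2 : HasDerivAt (quad a b δ c d ∘ fun s : ℝ => z + s • v) _ 0 :=
    (((hx c.1).const_mul a).add (((hy z.2.1 v.2.1 c.2.1).add (hy z.2.2 v.2.2 c.2.2)).const_mul b)).add
    ((((hx d.1).add (hy z.2.1 v.2.1 d.2.1)).add (hy z.2.2 v.2.2 d.2.2)).const_mul δ)
  exact h1.unique h2

lemma quad_pdT (a b δ : ℝ) (c d : Dom n) (z : Dom n) : pdT (quad a b δ c d) z =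
    2 * b * (z.2.2 - c.2.2) + 2 * δ * (z.2.2 - d.2.2) := by
  rw [pdT, quad_fderiv]; simp; ring

lemma quad_pdY (a b δ : ℝ) (c d : Dom n) (z : Dom n) : pdY (quad a b δ c d) z =
    2 * b * (z.2.1 - c.2.1) + 2 * δ * (z.2.1 - d.2.1) := by
  rw [pdY, quad_fderiv]; simp; ring

lemma quad_pdX (a b δ : ℝ) (c d : Dom n) (z : Dom n) : pdX (quad a b δ c d) z =
    (2 * a) • (z.1 - c.1) + (2 * δ) • (z.1 - d.1) := by
  ext i
  simp only [pdX, quad_fderiv]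
  simp [EuclideanSpace.inner_single_right]; ring

end per

section cmp
variable {n : ℕ} {G : Ham n}

/-- Sum of squares. -/
def nsq (z : Dom n) : ℝ := ‖z.1‖ ^ 2 + (z.2.1 ^ 2 + z.2.2 ^ 2)

lemma le_nsq {z : Dom n} {ρ : ℝ} (h0 : 0 ≤ ρ) (h : ρ < ‖z‖) : ρ ^ 2 ≤ nsq z := by
  unfold nsq
  have e1 := sq_nonneg ‖z.1‖
  have e2 := sq_nonneg z.2.1
  have e3 := sq_nonneg z.2.2
  rw [Prod.norm_def, Prod.norm_def, lt_max_iff, lt_max_iff] at h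
  rcases h with h | h | h
  · nlinarith
  · have := pow_le_pow_left₀ h0 h.le 2
    rw [Real.norm_eq_abs, sq_abs] at this
    linarith
  · have := pow_le_pow_left₀ h0 h.le 2
    rw [Real.norm_eq_abs, sq_abs] at this
    linarith

lemma nsq_continuous : Continuous (nsq (n := n)) := by
  unfold nsq
  exact (continuous_fst.norm.pow 2).add ((continuous_snd.fst.pow 2).add (continuous_snd.snd.pow 2))

/-- The doubled functional. -/
def dbl (u v : Dom n → ℝ) (a b : ℝ) (z z' : Dom n) : ℝ :=
  u z - v z' - (a * ‖z.1 - z'.1‖ ^ 2 + b * ((z.2.1 - z'.2.1) ^ 2 + (z.2.2 - z'.2.2) ^ 2))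

lemma exists_max_s11 {u v : Dom n → ℝ} (hu : UpperSemicontinuous u) (hv : LowerSemicontinuous v)
    {M : ℝ} (hM : 0 ≤ M) (huM : ∀ z, |u z| ≤ M) (hvM : ∀ z, |v z| ≤ M) {a b δ : ℝ} (ha : 0 < a)
    (hb : 0 < b) (hδ : 0 < δ) (c : Dom n) : ∃ Z Z' : Dom n, ∀ z z',
      dbl u v a b z z' - δ * nsq (z - c) ≤ dbl u v a b Z Z' - δ * nsq (Z - c) := by
  set Φ : Dom n × Dom n → ℝ := fun W => dbl u v a b W.1 W.2 - δ * nsq (W.1 - c) with hΦ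
  have husc : UpperSemicontinuous Φ := by
    have e : Φ = fun W => (u W.1 + (-v W.2)) + (-(a * ‖W.1.1 - W.2.1‖ ^ 2 +
      b * ((W.1.2.1 - W.2.2.1) ^ 2 + (W.1.2.2 - W.2.2.2) ^ 2)) - δ * nsq (W.1 - c)) := by
      funext W; simp only [hΦ, dbl]; ring
    rw [e]
    refine UpperSemicontinuous.add (UpperSemicontinuous.add ?_ ?_) (Continuous.upperSemicontinuous ?_)
    · intro W y hy
      exact continuous_fst.continuousAt.eventually (hu W.1 y hy)
    · intro W y hy
      have h1 : -y < v W.2 := by linarith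
      have := (continuous_snd (X := Dom n)).continuousAt.eventually (hv W.2 (-y) h1)
      filter_upwards [this] with W' hW'
      linarith
    · refine Continuous.sub (Continuous.neg (Continuous.add (continuous_const.mul
        ((continuous_fst.fst.sub continuous_snd.fst).norm.pow 2)) (continuous_const.mul
        (Continuous.add ?_ ?_)))) (continuous_const.mul
        (nsq_continuous.comp (continuous_fst.sub continuous_const)))
      · exact (continuous_fst.snd.fst.sub continuous_snd.snd.fst).pow 2
      · exact (continuous_fst.snd.snd.sub continuous_snd.snd.snd).pow 2
  obtain ⟨m, hm0, hma, hmb, hmδ⟩ : ∃ m > 0, m ≤ a ∧ m ≤ b ∧ m ≤ δ :=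
    ⟨min a (min b δ), by positivity, by simp, by simp, by simp⟩
  set ρ : ℝ := 4 * M / m + 1 with hρ
  have hρ1 : 1 ≤ ρ := by
    have : 0 ≤ 4 * M / m := by positivity
    linarith
  have hmρ : 4 * M ≤ m * ρ ^ 2 := by
    have : m * ρ = 4 * M + m := by rw [hρ]; field_simp
    nlinarith
  have hK : IsCompact (Metric.closedBall c ρ ×ˢ Metric.closedBall c (2 * ρ)) :=
    (isCompact_closedBall _ _).prod (isCompact_closedBall _ _)
  have hcK : (c, c) ∈ Metric.closedBall c ρ ×ˢ Metric.closedBall c (2 * ρ) :=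
    ⟨Metric.mem_closedBall_self (by linarith), Metric.mem_closedBall_self (by linarith)⟩
  obtain ⟨W, -, hW⟩ := UpperSemicontinuousOn.exists_isMaxOn ⟨_, hcK⟩ hK
    (husc.upperSemicontinuousOn _)
  have hcW : -(2 * M) ≤ Φ W := by
    have h1 : Φ (c, c) ≤ Φ W := hW hcK
    have h2 : Φ (c, c) = u c - v c := by simp [hΦ, dbl, nsq]
    have := abs_le.1 (huM c)
    have := abs_le.1 (hvM c)
    linarith
  refine ⟨W.1, W.2, fun z z' => ?_⟩
  by_cases hz : (z, z') ∈ Metric.closedBall c ρ ×ˢ Metric.closedBall c (2 * ρ)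
  · exact hW hz
  refine le_trans ?_ hcW
  have h1 := abs_le.1 (huM z)
  have h2 := abs_le.1 (hvM z')
  have hn : ∀ w : Dom n, 0 ≤ nsq w := fun w => by unfold nsq; positivity
  have hquad : m * nsq (z - z') ≤ a * ‖z.1 - z'.1‖ ^ 2 +
      b * ((z.2.1 - z'.2.1) ^ 2 + (z.2.2 - z'.2.2) ^ 2) := by
    have e1 : m * ‖z.1 - z'.1‖ ^ 2 ≤ a * ‖z.1 - z'.1‖ ^ 2 := by gcongr
    have e2 : m * ((z.2.1 - z'.2.1) ^ 2 + (z.2.2 - z'.2.2) ^ 2) ≤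
      b * ((z.2.1 - z'.2.1) ^ 2 + (z.2.2 - z'.2.2) ^ 2) := by gcongr
    simp only [nsq, Prod.fst_sub, Prod.snd_sub]
    linarith
  have hpen : m * nsq (z - c) ≤ δ * nsq (z - c) := by
    have := hn (z - c)
    gcongr
  have hbig : ρ ^ 2 ≤ nsq (z - c) ∨ ρ ^ 2 ≤ nsq (z - z') := by
    by_cases hzc : ρ < ‖z - c‖
    · exact Or.inl (le_nsq (by linarith) hzc)
    · right
      refine le_nsq (by linarith) ?_
      by_contra hcon
      push Not at hzc hcon
      apply hz
      refine ⟨by simpa [dist_eq_norm] using hzc, ?_⟩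
      simp only [Metric.mem_closedBall, dist_eq_norm]
      have : z' - c = (z - c) - (z - z') := by abel
      rw [this]
      exact (norm_sub_le _ _).trans (by linarith)
  have hn1 := hn (z - c)
  have hn2 := hn (z - z')
  have : m * ρ ^ 2 ≤ m * nsq (z - c) + m * nsq (z - z') := by
    rw [← mul_add]
    apply mul_le_mul_of_nonneg_left _ hm0.le
    rcases hbig with h | h <;> linarith
  simp only [dbl]
  linarith

set_option maxHeartbeats 2000000 in
lemma core {C₁ C₂ l C₃ C₄ C₅ : ℝ}
    (h1 : HypH1 G) (h2 : HypH2 G C₁ C₂) (h3 : HypH3 G l C₃ C₄ C₅) {α₁ α₂ l₁ l₂ M : ℝ}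
    {u v : Dom n → ℝ} (hu : ViscSub G α₁ l₁ u) (hv : ViscSuper G α₂ l₂ v) (hM : 0 ≤ M)
    (huM : ∀ z, |u z| ≤ M) (hvM : ∀ z, |v z| ≤ M) {b θ : ℝ} (hb : 0 < b) (hθ : 0 < θ)
    (hθ1 : θ ≤ 1) : ∃ A > 0, ∀ a ≥ A, ∀ μ, (∀ z z', dbl u v a b z z' ≤ μ) →
      ∀ c c', μ - θ ≤ dbl u v a b c c' → ∃ z z' : Dom n, ∃ px : Euc n, ∃ py pt : ℝ,
        μ - θ ≤ dbl u v a b z z' ∧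
        py = 2 * b * (z.2.1 - z'.2.1) ∧ pt = 2 * b * (z.2.2 - z'.2.2) ∧
        α₁ * u z - l₁ - (α₂ * v z' - l₂) ≤ 2 * θ + (G z'.1 z'.2.1 z'.2.2 px py -
          G z'.1 z.2.1 z.2.2 px py) ∧
        |G z'.1 z.2.1 z.2.2 px py| ≤ (|l₁| + |α₁| * M + 2 + C₂) + |pt| + C₅ * |py| := by
  have hC1 := h2.1
  have hC2 := h2.2.1
  have hC5 := h3.2.2.1
  set K : ℝ := 4 * M + 1 with hK
  set P : ℝ := 2 * (b + K) with hP
  set Q : ℝ := (|l₁| + |α₁| * M + (P + 1) + C₂ + C₅ * (P + 1)) / C₁ with hQ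
  have hP0 : 0 ≤ P := by positivity
  have hQ0 : 0 ≤ Q := by positivity
  obtain ⟨r₀, hr₀, hr₀G⟩ := unif_G h1 (Q + P + 2) hθ
  obtain ⟨r, hr, hrr, hr1, hrθ⟩ : ∃ r > 0, r ≤ r₀ ∧ r ≤ 1 ∧ r ≤ θ :=
    ⟨min r₀ (min 1 θ), by positivity, by simp, by simp, by simp⟩
  refine ⟨K / r ^ 2, by positivity, ?_⟩
  intro a ha μ hμ c c' hc
  have hApos : 0 < K / r ^ 2 := by positivity
  have ha0 : 0 < a := lt_of_lt_of_le hApos ha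
  have hKa : K ≤ a * r ^ 2 := by rwa [ge_iff_le, div_le_iff₀ (by positivity)] at ha
  set δ : ℝ := r ^ 2 / 4 with hδ
  have hδ0 : 0 < δ := by positivity
  obtain ⟨z, z', hmax⟩ := exists_max_s11 hu.1 hv.1 hM huM hvM ha0 hb hδ0 c
  have hn : ∀ w : Dom n, 0 ≤ nsq w := fun w => by unfold nsq; positivity
  have hc2 := hmax c c'
  have hcc : nsq (c - c) = 0 := by simp [nsq]
  rw [hcc, mul_zero, sub_zero] at hc2
  have hpos : 0 ≤ δ * nsq (z - c) := mul_nonneg hδ0.le (hn _)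
  have hpen : δ * nsq (z - c) ≤ 1 := by have := hμ z z'; linarith
  have hge : μ - θ ≤ dbl u v a b z z' := by linarith
  -- the penalization is bounded
  have huz := abs_le.1 (huM z)
  have hvz := abs_le.1 (hvM z')
  have hμ0 : -(2 * M) ≤ μ := by
    have e := hμ z z
    have e2 : dbl u v a b z z = u z - v z := by simp [dbl]
    have := abs_le.1 (hvM z)
    linarith
  have hKb : a * ‖z.1 - z'.1‖ ^ 2 +
      b * ((z.2.1 - z'.2.1) ^ 2 + (z.2.2 - z'.2.2) ^ 2) ≤ K := by
    simp only [dbl] at hge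
    linarith
  have s1 : 0 ≤ a * ‖z.1 - z'.1‖ ^ 2 := by positivity
  have s2 : 0 ≤ b * (z.2.1 - z'.2.1) ^ 2 := by positivity
  have s3 : 0 ≤ b * (z.2.2 - z'.2.2) ^ 2 := by positivity
  have hxx : ‖z.1 - z'.1‖ ≤ r := by
    have : a * ‖z.1 - z'.1‖ ^ 2 ≤ a * r ^ 2 := by linarith
    have := le_of_mul_le_mul_left this ha0
    exact le_of_sq_le_sq this hr.le
  have hbd : ∀ s : ℝ, b * s ^ 2 ≤ K → |2 * b * s| ≤ P := by
    intro s hs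
    apply abs_le_of_sq_le_sq _ hP0
    rw [hP]
    nlinarith [sq_nonneg (b - K)]
  have hqd : ∀ s : ℝ, δ * s ^ 2 ≤ 1 → |2 * δ * s| ≤ r := by
    intro s hs
    apply abs_le_of_sq_le_sq _ hr.le
    have : (2 * δ * s) ^ 2 = r ^ 2 * (δ * s ^ 2) := by rw [hδ]; ring
    rw [this]
    nlinarith [sq_nonneg r]
  have hpen' : δ * ‖z.1 - c.1‖ ^ 2 + (δ * (z.2.1 - c.2.1) ^ 2 + δ * (z.2.2 - c.2.2) ^ 2) ≤ 1 := by
    have e : δ * nsq (z - c) = δ * ‖z.1 - c.1‖ ^ 2 + (δ * (z.2.1 - c.2.1) ^ 2 +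
      δ * (z.2.2 - c.2.2) ^ 2) := by simp only [nsq, Prod.fst_sub, Prod.snd_sub]; ring
    linarith
  have d1 : 0 ≤ δ * ‖z.1 - c.1‖ ^ 2 := by positivity
  have d2 : 0 ≤ δ * (z.2.1 - c.2.1) ^ 2 := by positivity
  have d3 : 0 ≤ δ * (z.2.2 - c.2.2) ^ 2 := by positivity
  -- viscosity inequalities
  have hsub := hu.2 (quad a b δ z' c) (quad_contDiff _ _ _ _ _) z (by
    refine Filter.Eventually.of_forall fun ζ => ?_
    have := hmax ζ z'
    simp only [dbl, nsq, quad, Prod.fst_sub, Prod.snd_sub] at this ⊢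
    linarith)
  have hsup := hv.2 (quad (-a) (-b) 0 z z) (quad_contDiff _ _ _ _ _) z' (by
    refine Filter.Eventually.of_forall fun ζ => ?_
    have := hmax z ζ
    simp only [dbl, quad] at this ⊢
    rw [norm_sub_rev ζ.1, norm_sub_rev z'.1]
    nlinarith)
  rw [quad_pdT, quad_pdX, quad_pdY] at hsub hsup
  set px : Euc n := (2 * a) • (z.1 - z'.1) with hpx
  set py : ℝ := 2 * b * (z.2.1 - z'.2.1) with hpy
  set pt : ℝ := 2 * b * (z.2.2 - z'.2.2) with hpt
  set qx : Euc n := (2 * δ) • (z.1 - c.1) with hqx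
  set qy : ℝ := 2 * δ * (z.2.1 - c.2.1) with hqy
  set qt : ℝ := 2 * δ * (z.2.2 - c.2.2) with hqt
  have ex : (2 * -a) • (z'.1 - z.1) + (2 * (0:ℝ)) • (z'.1 - z.1) = px := by
    rw [hpx, mul_zero, zero_smul, add_zero, mul_neg, neg_smul, ← smul_neg, neg_sub]
  have ey : 2 * -b * (z'.2.1 - z.2.1) + 2 * 0 * (z'.2.1 - z.2.1) = py := by rw [hpy]; ring
  have et : 2 * -b * (z'.2.2 - z.2.2) + 2 * 0 * (z'.2.2 - z.2.2) = pt := by rw [hpt]; ring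
  rw [ex, ey, et] at hsup
  have hpyP : |py| ≤ P := hbd _ (by linarith)
  have hptP : |pt| ≤ P := hbd _ (by linarith)
  have hqyr : |qy| ≤ r := hqd _ (by linarith)
  have hqtr : |qt| ≤ r := hqd _ (by linarith)
  have hqxr : ‖qx‖ ≤ r := by
    have := hqd ‖z.1 - c.1‖ (by linarith)
    rw [hqx, norm_smul, Real.norm_eq_abs]
    rwa [abs_mul, abs_norm] at this
  have hαu : |α₁ * u z| ≤ |α₁| * M := by
    rw [abs_mul]; exact mul_le_mul_of_nonneg_left (huM z) (abs_nonneg _)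
  have hαu' := abs_le.1 hαu
  have hl1 := le_abs_self l₁
  have hpt' := abs_le.1 hptP
  have hqt' := abs_le.1 hqtr
  have hpxq : ‖px + qx‖ ≤ Q := by
    rw [hQ, le_div_iff₀ hC1]
    have e1 := h2.2.2 z.1 z.2.1 z.2.2 (px + qx)
    have e2 := abs_le.1 (reg_p h1 h3 z.1 z.2.1 z.2.2 (px + qx) 0 (py + qy))
    have e3 : C₅ * |py + qy - 0| ≤ C₅ * (P + 1) := by
      rw [sub_zero]
      have := abs_add_le py qy
      gcongr
      linarith
    linarith
  have hpxR : ‖px‖ ≤ Q + P + 2 := by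
    have : px = (px + qx) - qx := by abel
    rw [this]
    exact (norm_sub_le _ _).trans (by linarith)
  have hGG := abs_le.1 (hr₀G z.1 z'.1 z.2.1 z.2.2 (px + qx) px (py + qy) py (by linarith) hpxR
    ((abs_add_le _ _).trans (by linarith)) (by linarith) (hxx.trans hrr)
    (by simpa using hqxr.trans hrr) (by simpa using hqyr.trans hrr))
  refine ⟨z, z', px, py, pt, hge, hpy, hpt, by linarith, ?_⟩
  have e1 := h2.2.2 z'.1 z.2.1 z.2.2 px
  have e2 := abs_le.1 (reg_p h1 h3 z'.1 z.2.1 z.2.2 px 0 py)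
  rw [sub_zero] at e2
  have e3 : 0 ≤ C₁ * ‖px‖ := by positivity
  have e4 : 0 ≤ C₅ * |py| := by positivity
  have e5 := abs_nonneg pt
  have e6 := neg_abs_le pt
  have e7 := abs_nonneg l₁
  have e8 : 0 ≤ |α₁| * M := by positivity
  rw [abs_le]
  constructor <;> linarith

set_option maxHeartbeats 2000000 in
lemma visc_compare {C₁ C₂ l C₃ C₄ C₅ : ℝ}
    (h1 : HypH1 G) (h2 : HypH2 G C₁ C₂) (h3 : HypH3 G l C₃ C₄ C₅) {α₁ α₂ l₁ l₂ M : ℝ}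
    {u v : Dom n → ℝ} (hu : ViscSub G α₁ l₁ u) (hv : ViscSuper G α₂ l₂ v) (hM : 0 ≤ M)
    (huM : ∀ z, |u z| ≤ M) (hvM : ∀ z, |v z| ≤ M) {θ : ℝ} (hθ : 0 < θ) : ∃ z z' : Dom n,
      (∀ ζ, u ζ - v ζ ≤ u z - v z' + θ) ∧ α₁ * u z - l₁ ≤ α₂ * v z' - l₂ + θ := by
  have hC2 := h2.2.1
  have hC3 := h3.1
  have hC4 := h3.2.1
  have hC5 := h3.2.2.1
  set L : ℝ := |l₁| + |α₁| * M + 2 + C₂ with hL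
  have hL0 : 0 ≤ L := by positivity
  set D : ℝ := C₃ * (2 + |l|) + 2 * C₄ * (5 + L + 2 * C₅) with hD
  have hD0 : 0 ≤ D := by positivity
  obtain ⟨s, hs0, hs1, hsC, hsD⟩ : ∃ s > 0, s ≤ 1 ∧ C₄ * s ≤ 1 / 2 ∧ D * s ≤ θ / 2 := by
    refine ⟨min 1 (min (1 / (2 * (C₄ + 1))) (θ / (2 * (D + 1)))), by positivity, by simp, ?_, ?_⟩
    · calc _ ≤ C₄ * (1 / (2 * (C₄ + 1))) := by gcongr; simp
        _ ≤ 1 / 2 := by rw [mul_one_div, div_le_div_iff₀ (by positivity) (by positivity)]; linarith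
    · calc _ ≤ D * (θ / (2 * (D + 1))) := by gcongr; simp
        _ ≤ θ / 2 := by
          rw [mul_div_assoc', div_le_div_iff₀ (by positivity) (by positivity)]; nlinarith
  obtain ⟨τ, hτ0, hτ1, hτθ, hτs⟩ : ∃ τ > 0, τ ≤ 1 ∧ τ ≤ θ / 4 ∧ 4 * τ ≤ s ^ 2 := by
    refine ⟨min 1 (min (θ / 4) (s ^ 2 / 4)), by positivity, by simp, by simp, ?_⟩
    have : min 1 (min (θ / 4) (s ^ 2 / 4)) ≤ s ^ 2 / 4 := by simp
    linarith
  have hcore := fun k : ℕ => core h1 h2 h3 hu hv hM huM hvM (b := 2 ^ k) (by positivity) hτ0 hτ1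
  choose A hA0 hA using hcore
  set a : ℕ → ℝ := fun k => ∑ j ∈ Finset.range (k + 1), A j with ha
  have haA : ∀ k, A k ≤ a k := fun k =>
    Finset.single_le_sum (f := A) (fun j _ => (hA0 j).le) (Finset.self_mem_range_succ k)
  have ha_succ : ∀ k, a k ≤ a (k + 1) := fun k => by
    simp only [ha]
    rw [Finset.sum_range_succ _ (k + 1)]
    linarith [hA0 (k + 1)]
  have ha0 : ∀ k, 0 < a k := fun k => (hA0 k).trans_le (haA k)
  set Ψ : ℕ → Dom n × Dom n → ℝ := fun k W => dbl u v (a k) (2 ^ k) W.1 W.2 with hΨ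
  have hΨ_le : ∀ k W, Ψ k W ≤ 2 * M := by
    intro k W
    have e1 := abs_le.1 (huM W.1)
    have e2 := abs_le.1 (hvM W.2)
    have e3 : 0 ≤ a k * ‖W.1.1 - W.2.1‖ ^ 2 + 2 ^ k * ((W.1.2.1 - W.2.2.1) ^ 2 +
      (W.1.2.2 - W.2.2.2) ^ 2) := by have := ha0 k; positivity
    simp only [hΨ, dbl]
    linarith
  have hbdd : ∀ k, BddAbove (Set.range (Ψ k)) := fun k =>
    ⟨2 * M, by rintro _ ⟨W, rfl⟩; exact hΨ_le k W⟩
  set μ : ℕ → ℝ := fun k => ⨆ W, Ψ k W with hμ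
  have hle : ∀ k W, Ψ k W ≤ μ k := fun k W => le_ciSup (hbdd k) W
  have hdiag : ∀ k ζ, Ψ k (ζ, ζ) = u ζ - v ζ := fun k ζ => by simp [hΨ, dbl]
  have hstep : ∀ k (W : Dom n × Dom n), Ψ (k + 1) W + 2 ^ k * ((W.1.2.1 - W.2.2.1) ^ 2 +
      (W.1.2.2 - W.2.2.2) ^ 2) ≤ Ψ k W := by
    intro k W
    simp only [hΨ, dbl]
    have : a k * ‖W.1.1 - W.2.1‖ ^ 2 ≤ a (k + 1) * ‖W.1.1 - W.2.1‖ ^ 2 := by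
      gcongr; exact ha_succ k
    rw [pow_succ (2:ℝ) k]
    linarith
  have hanti : Antitone μ := by
    refine antitone_nat_of_succ_le fun k => ciSup_mono (hbdd k) fun W => ?_
    have := hstep k W
    have : 0 ≤ (2:ℝ) ^ k * ((W.1.2.1 - W.2.2.1) ^ 2 + (W.1.2.2 - W.2.2.2) ^ 2) := by positivity
    linarith
  have hμbelow : BddBelow (Set.range μ) := by
    refine ⟨-(2 * M), ?_⟩
    rintro _ ⟨k, rfl⟩
    have e := hle k (0, 0)
    rw [hdiag] at e
    have e1 := abs_le.1 (huM 0)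
    have e2 := abs_le.1 (hvM 0)
    linarith
  have hlim := tendsto_atTop_ciInf hanti hμbelow
  have hlim2 := hlim.sub (hlim.comp (tendsto_add_atTop_nat 1))
  rw [sub_self] at hlim2
  obtain ⟨k, hk⟩ := (hlim2.eventually (gt_mem_nhds hτ0)).exists
  simp only [Function.comp] at hk
  obtain ⟨W₀, hW₀⟩ := exists_lt_of_lt_ciSup (show μ (k + 1) - τ < ⨆ W, Ψ (k + 1) W by
    change _ < μ (k + 1); linarith)
  obtain ⟨z, z', px, py, pt, hge, hpy, hpt, hE, hG⟩ := hA (k + 1) (a (k + 1)) (haA _) (μ (k + 1))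
    (fun z z' => hle (k + 1) (z, z')) W₀.1 W₀.2 hW₀.le
  have hge' : μ (k + 1) - τ ≤ Ψ (k + 1) (z, z') := hge
  refine ⟨z, z', fun ζ => ?_, ?_⟩
  · have e1 := hle (k + 1) (ζ, ζ)
    rw [hdiag] at e1
    have e3 : 0 ≤ a (k + 1) * ‖z.1 - z'.1‖ ^ 2 + 2 ^ (k + 1) * ((z.2.1 - z'.2.1) ^ 2 +
      (z.2.2 - z'.2.2) ^ 2) := by have := ha0 (k + 1); positivity
    simp only [hΨ, dbl] at hge'
    linarith
  have hσ : 2 ^ (k + 1) * ((z.2.1 - z'.2.1) ^ 2 + (z.2.2 - z'.2.2) ^ 2) ≤ s ^ 2 := by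
    have e1 := hstep k (z, z')
    have e2 := hle k (z, z')
    simp only at e1
    rw [pow_succ (2:ℝ) k]
    linarith
  have hb1 : (1:ℝ) ≤ 2 ^ (k + 1) := one_le_pow₀ (by norm_num)
  generalize (2:ℝ) ^ (k + 1) = b at hσ hb1 hpy hpt
  have hYb : b * |z.2.1 - z'.2.1| ^ 2 ≤ s ^ 2 := by
    rw [sq_abs]; nlinarith [mul_nonneg (zero_le_one.trans hb1) (sq_nonneg (z.2.2 - z'.2.2))]
  have hTb : b * |z.2.2 - z'.2.2| ^ 2 ≤ s ^ 2 := by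
    rw [sq_abs]; nlinarith [mul_nonneg (zero_le_one.trans hb1) (sq_nonneg (z.2.1 - z'.2.1))]
  have hpya : |py| = 2 * b * |z.2.1 - z'.2.1| := by
    rw [hpy, abs_mul, abs_of_nonneg (by linarith : 0 ≤ 2 * b)]
  have hpta : |pt| = 2 * b * |z.2.2 - z'.2.2| := by
    rw [hpt, abs_mul, abs_of_nonneg (by linarith : 0 ≤ 2 * b)]
  have ry := (abs_le.1 (reg_y h1 h3 z'.1 z'.2.2 px py z.2.1 z'.2.1)).2
  rw [abs_sub_comm z'.2.1] at ry
  have hY0 := abs_nonneg (z.2.1 - z'.2.1)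
  have hT0 := abs_nonneg (z.2.2 - z'.2.2)
  have hYs : |z.2.1 - z'.2.1| ≤ s := le_of_sq_le_sq (by nlinarith) hs0.le
  have hTs : |z.2.2 - z'.2.2| ≤ s := le_of_sq_le_sq (by nlinarith) hs0.le
  have rt := (abs_le.1 (reg_t h1 h3 z'.1 z.2.1 px py z.2.2 z'.2.2 (by
    rw [abs_sub_comm]
    exact (mul_le_mul_of_nonneg_left hTs hC4).trans hsC))).2
  rw [abs_sub_comm z'.2.2] at rt
  generalize |z.2.1 - z'.2.1| = Y at *
  generalize |z.2.2 - z'.2.2| = T at *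
  have hss : s ^ 2 ≤ s := by nlinarith
  have hYT : b * (Y * T) ≤ s ^ 2 := by nlinarith [sq_nonneg (Y - T)]
  have fy : C₃ * |py + l| * Y ≤ C₃ * ((2 + |l|) * s) := by
    rw [mul_assoc]
    apply mul_le_mul_of_nonneg_left _ hC3
    have := abs_add_le py l
    have h0 := abs_nonneg l
    calc |py + l| * Y ≤ (|py| + |l|) * Y := by gcongr
      _ = 2 * (b * Y ^ 2) + |l| * Y := by rw [hpya]; ring
      _ ≤ 2 * s + |l| * s := by gcongr; linarith
      _ = _ := by ring
  have ft : 2 * C₄ * T * (1 + |py| + |G z'.1 z.2.1 z.2.2 px py|) ≤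
      2 * C₄ * ((5 + L + 2 * C₅) * s) := by
    rw [mul_assoc (2 * C₄)]
    apply mul_le_mul_of_nonneg_left _ (by positivity)
    calc T * (1 + |py| + |G z'.1 z.2.1 z.2.2 px py|)
        ≤ T * (1 + |py| + (L + |pt| + C₅ * |py|)) := by gcongr
      _ = (1 + L) * T + (2 + 2 * C₅) * (b * (Y * T)) + 2 * (b * T ^ 2) := by
          rw [hpya, hpta]; ring
      _ ≤ (1 + L) * s + (2 + 2 * C₅) * s + 2 * s := by
          gcongr <;> linarith
      _ = (5 + L + 2 * C₅) * s := by ring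
  have : D * s = C₃ * ((2 + |l|) * s) + 2 * C₄ * ((5 + L + 2 * C₅) * s) := by rw [hD]; ring
  linarith

end cmp
/-- Under (H1)–(H3), if w^α is, for each α > 0, the continuous
space-time periodic viscosity solution of `w_t + G + α w = 0`, then -α w^α converges
uniformly on ℝⁿ×ℝ×ℝ, as α → 0⁺, to the ergodic constant λ̄. -/
theorem statement11 {n : ℕ} (hn : 0 < n) (G : Ham n) (C₁ C₂ l C₃ C₄ C₅ : ℝ)
    (h1 : HypH1 G) (h2 : HypH2 G C₁ C₂) (h3 : HypH3 G l C₃ C₄ C₅)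
    (lam : ℝ) (hlam : ErgodicConst G lam)
    (w : ℝ → Dom n → ℝ)
    (hw : ∀ α : ℝ, 0 < α → STPeriodic (w α) ∧ ViscSol G α 0 (w α)) :
    TendstoUniformly (fun (α : ℝ) (z : Dom n) => -(α * w α z)) (fun _ => lam)
      (nhdsWithin (0 : ℝ) (Set.Ioi 0)) := by
  obtain ⟨⟨u, ⟨Mu, huM⟩, hu⟩, ⟨v, ⟨Mv, hvM⟩, hv⟩⟩ := hlam
  have hMu : 0 ≤ Mu := (abs_nonneg _).trans (huM 0)
  have hMv : 0 ≤ Mv := (abs_nonneg _).trans (hvM 0)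
  -- quantitative estimate
  have key : ∀ α : ℝ, 0 < α → ∀ ζ : Dom n,
      |lam - -(α * w α ζ)| ≤ α * (2 * (Mu + Mv) + α + 1) := by
    intro α hα ζ
    obtain ⟨hper, hcont, hsub, hsup⟩ := hw α hα
    obtain ⟨Mw, hwM⟩ := bdd_of_periodic hper hcont
    have hMw : 0 ≤ Mw := (abs_nonneg _).trans (hwM 0)
    obtain ⟨z₁, z₁', hz₁, he₁⟩ := visc_compare h1 h2 h3 hu hsup (M := Mu + Mw) (by positivity)
      (fun z => (huM z).trans (by linarith)) (fun z => (hwM z).trans (by linarith)) hα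
    obtain ⟨z₂, z₂', hz₂, he₂⟩ := visc_compare h1 h2 h3 hsub hv (M := Mv + Mw) (by positivity)
      (fun z => (hwM z).trans (by linarith)) (fun z => (hvM z).trans (by linarith)) hα
    have a1 := hz₁ ζ
    have a2 := hz₂ ζ
    have b1 := abs_le.1 (huM z₁)
    have b2 := abs_le.1 (huM ζ)
    have b3 := abs_le.1 (hvM z₂')
    have b4 := abs_le.1 (hvM ζ)
    have c1 : α * (w α z₁' - w α ζ) ≤ α * (2 * Mu + α) :=
      mul_le_mul_of_nonneg_left (by linarith) hα.le
    have c2 : α * (w α ζ - w α z₂) ≤ α * (2 * Mv + α) :=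
      mul_le_mul_of_nonneg_left (by linarith) hα.le
    have d1 : 0 ≤ α * Mu := by positivity
    have d2 : 0 ≤ α * Mv := by positivity
    rw [abs_le]
    constructor <;> nlinarith
  rw [Metric.tendstoUniformly_iff]
  intro ε hε
  have hlim : Tendsto (fun α : ℝ => α * (2 * (Mu + Mv) + α + 1)) (nhdsWithin 0 (Set.Ioi 0))
      (nhds 0) := by
    have : Continuous (fun α : ℝ => α * (2 * (Mu + Mv) + α + 1)) :=
      continuous_id.mul ((continuous_const.add continuous_id).add continuous_const)
    have h := this.tendsto 0
    rw [zero_mul] at h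
    exact h.mono_left nhdsWithin_le_nhds
  filter_upwards [hlim.eventually (gt_mem_nhds hε), self_mem_nhdsWithin] with α h hα ζ
  rw [Real.dist_eq]
  exact (key α hα ζ).trans_lt h
end
end
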